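/- arXiv:2603.21451 — 4 statements merged into one kernel-verified Lean document; each statement's English description precedes it below -/
import Mathlib

section
/- Spectral synthesis for thinly supported measures on the torus (Theorem 1.1 together with Remark 1.2, case M = 𝕋^d): Let d ≥ 1, let k be a real number with 1 ≤ k < d, and let E ⊆ 𝕋^d be a compact set for which there exist constants C_E > 0 and δ₀ ∈ (0,1] such that volume(E^δ) ≤ C_E · δ^{d−k} for all 0 < δ ≤ δ₀. Let μ be a finite complex Borel measure on 𝕋^d whose topological support is contained in E. If Σ_{n ∈ ℕ} a_n(μ)^p < ∞ for some real p with 2 ≤ p ≤ 2d/k, then μ = 0. -/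
open MeasureTheory Complex Filter FourierTransform Metric
open scoped Real

noncomputable section

abbrev Torus (d : ℕ) := Fin d → AddCircle (1 : ℝ)

/-- The character `e_j(x) = ∏ m, exp(2πi j_m x_m)` on the torus. -/
def torusChar {d : ℕ} (j : Fin d → ℤ) (x : Torus d) : ℂ :=
  ∏ m, fourier (j m) (x m)

/-- `|j| = (Σ_m j_m²)^{1/2}` for a frequency `j : Fin d → ℤ`. -/
def jnorm {d : ℕ} (j : Fin d → ℤ) : ℝ :=
  Real.sqrt (∑ m, ((j m : ℝ)) ^ 2)

/-- Integration of a complex-valued function against a finite complex measure,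
via the Jordan decompositions of the real and imaginary parts. -/
def cIntegral {X : Type*} [MeasurableSpace X] (μ : ComplexMeasure X) (f : X → ℂ) : ℂ :=
  ((∫ x, f x ∂((ComplexMeasure.re μ).toJordanDecomposition.posPart))
    - (∫ x, f x ∂((ComplexMeasure.re μ).toJordanDecomposition.negPart)))
  + Complex.I * ((∫ x, f x ∂((ComplexMeasure.im μ).toJordanDecomposition.posPart))
    - (∫ x, f x ∂((ComplexMeasure.im μ).toJordanDecomposition.negPart)))

/-- The Fourier coefficient `μ̂(j) = ∫ conj (e_j) dμ` of a finite complex measure. -/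
def muHat {d : ℕ} (μ : ComplexMeasure (Torus d)) (j : Fin d → ℤ) : ℂ :=
  cIntegral μ (fun x => starRingEnd ℂ (torusChar j x))

/-- `a_n(μ) = ‖E_{√n} μ‖ = (Σ_{|j|² = n} |μ̂(j)|²)^{1/2}`, the `L²` norm of the spectral
projection of `μ` onto the Laplace eigenspace with eigenvalue `-n`. -/
def aCoeff {d : ℕ} (μ : ComplexMeasure (Torus d)) (n : ℕ) : ℝ :=
  Real.sqrt (∑' j : {j : Fin d → ℤ // (∑ m, (j m) ^ 2) = (n : ℤ)}, ‖muHat μ (j : Fin d → ℤ)‖ ^ 2)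

/-- The topological support of a complex measure: the set of points all of whose
neighborhoods contain a measurable set of nonzero measure. -/
def msupport {X : Type*} [TopologicalSpace X] [MeasurableSpace X] (μ : ComplexMeasure X) : Set X :=
  {x | ∀ U : Set X, IsOpen U → x ∈ U → ∃ A : Set X, MeasurableSet A ∧ A ⊆ U ∧ μ A ≠ 0}


lemma aux_pars {d : ℕ} (G : Torus d → ℂ) (hG : MemLp G 2 (volume : Measure (Torus d))) :
    HasSum (fun j : Fin d → ℤ => ‖∫ x, starRingEnd ℂ (torusChar j x) * G x‖ ^ 2)
      (∫ x, ‖G x‖ ^ 2) := by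
  have hv : (Measure.pi (fun _ : Fin d => (AddCircle.haarAddCircle : Measure (AddCircle (1:ℝ)))))
      = (volume : Measure (Torus d)) := by
    rw [volume_pi]
    congr 1
    funext i
    rw [AddCircle.volume_eq_smul_haarAddCircle]
    simp
  have hG' : MemLp G 2 (Measure.pi (fun _ : Fin d => (AddCircle.haarAddCircle : Measure (AddCircle (1:ℝ))))) := by
    rw [hv]; exact hG
  have key := UnitAddTorus.hasSum_sq_mFourierCoeff (d := Fin d) (MemLp.toLp G hG')
  have h1 : ∀ j : Fin d → ℤ, UnitAddTorus.mFourierCoeff (MemLp.toLp G hG') j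
      = ∫ x, starRingEnd ℂ (torusChar j x) * G x := by
    intro j
    unfold UnitAddTorus.mFourierCoeff
    rw [← hv]
    apply integral_congr_ae
    filter_upwards [MemLp.coeFn_toLp hG'] with x hx
    rw [hx, UnitAddTorus.mFourier_neg, smul_eq_mul]
    rfl
  simp only [h1] at key
  convert key using 1
  rw [← hv]
  apply integral_congr_ae
  filter_upwards [MemLp.coeFn_toLp hG'] with x hx
  rw [hx]

lemma aux_circ (δ : ℝ) (hδ : 0 < δ) (hδ2 : δ < 1 / 2) (n : ℤ) :
    ∫ t in closedBall (0 : AddCircle (1:ℝ)) δ, starRingEnd ℂ (fourier n t : ℂ)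
      = ((2 * δ * Real.sinc (2 * π * n * δ) : ℝ) : ℂ) := by
  have h1 : ∫ t in closedBall (0 : AddCircle (1:ℝ)) δ, starRingEnd ℂ (fourier n t : ℂ)
      = ∫ t in (-δ)..δ, starRingEnd ℂ (fourier n (t : AddCircle (1:ℝ)) : ℂ) := by
    rw [← integral_indicator measurableSet_closedBall, ← AddCircle.integral_preimage 1 (-(1/2)),
      intervalIntegral.integral_of_le (by linarith), ← integral_Icc_eq_integral_Ioc (x := -δ)]
    have e : ∀ t : ℝ, (closedBall (0 : AddCircle (1:ℝ)) δ).indicator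
        (fun t => starRingEnd ℂ (fourier n t : ℂ)) (t : AddCircle (1:ℝ))
        = ((fun t : ℝ => (t : AddCircle (1:ℝ))) ⁻¹' (closedBall (0 : AddCircle (1:ℝ)) δ)).indicator
          (fun t : ℝ => starRingEnd ℂ (fourier n (t : AddCircle (1:ℝ)) : ℂ)) t := fun t => rfl
    simp_rw [e]
    have hms : MeasurableSet ((fun t : ℝ => (t : AddCircle (1:ℝ))) ⁻¹' (closedBall (0 : AddCircle (1:ℝ)) δ)) :=
      AddCircle.measurable_mk' measurableSet_closedBall
    rw [integral_indicator hms, Measure.restrict_restrict hms]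
    congr 2
    have := AddCircle.coe_real_preimage_closedBall_inter_eq (p := 1) (x := 0) (ε := δ)
      (Set.Ioc (-(1/2)) (-(1/2) + 1)) (by
        rw [Real.closedBall_eq_Icc]; intro t ht; simp at ht ⊢; constructor <;> linarith)
    rw [abs_one, if_pos hδ2] at this
    refine this.trans ?_
    rw [Real.closedBall_eq_Icc]
    ext t; simp; intros; constructor <;> linarith
  rw [h1]
  by_cases hn : n = 0
  · subst hn
    simp [Real.sinc_zero]; ring
  have hnC : (n : ℂ) ≠ 0 := by exact_mod_cast hn
  have hpi : (π : ℂ) ≠ 0 := by exact_mod_cast Real.pi_ne_zero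
  have hx : 2 * π * n * δ ≠ 0 := by
    have : (n : ℝ) ≠ 0 := by exact_mod_cast hn
    have := Real.pi_ne_zero
    positivity
  rw [Real.sinc_of_ne_zero hx]
  have h2 : ∀ t : ℝ, starRingEnd ℂ (fourier n (t : AddCircle (1:ℝ)) : ℂ)
      = Complex.exp ((-(2 * π * n) * I) * t) := by
    intro t
    rw [← fourier_neg, fourier_coe_apply]
    congr 1; push_cast; ring
  simp_rw [h2]
  rw [integral_exp_mul_complex (by simp [hnC, hpi])]
  push_cast
  rw [Complex.sin]
  have hδC : (δ : ℂ) ≠ 0 := by exact_mod_cast hδ.ne'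
  have e1 : (-(2 * π * n) * I) * (δ:ℂ) = -(2 * π * n * δ) * I := by ring
  have e2 : (-(2 * π * n) * I) * (-δ:ℂ) = (2 * π * n * δ) * I := by ring
  rw [e1, e2]
  field_simp
  rw [I_sq]
  ring

lemma aux_block (q : ℝ) (hq : 1 < q) (L : ℕ) (hL : 0 < L) (T : Finset ℕ) :
    ∑ n ∈ T, ((1 + (1 / (L:ℝ)) ^ 2 * n)⁻¹) ^ q ≤ (L:ℝ) ^ 2 * ∑' m : ℕ, (1 / ((m + 1 : ℕ) : ℝ) ^ q) := by
  have hs : Summable (fun m : ℕ => (1 / ((m + 1 : ℕ) : ℝ) ^ q)) :=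
    (summable_nat_add_iff 1).2 (Real.summable_one_div_nat_rpow.2 hq)
  have hLr : (0:ℝ) < L := by exact_mod_cast hL
  have hind : ∀ M : ℕ, ∑ n ∈ Finset.range (L ^ 2 * M), ((1 + (1 / (L:ℝ)) ^ 2 * n)⁻¹) ^ q
      ≤ (L:ℝ) ^ 2 * ∑ m ∈ Finset.range M, (1 / ((m + 1 : ℕ) : ℝ) ^ q) := by
    intro M
    induction M with
    | zero => simp
    | succ M ih =>
      rw [mul_add, mul_one, Finset.sum_range_add, Finset.sum_range_succ, mul_add]
      refine add_le_add ih ?_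
      calc _ ≤ ∑ x ∈ Finset.range (L ^ 2), (1 / ((M + 1 : ℕ) : ℝ) ^ q) := by
            refine Finset.sum_le_sum fun x _ => ?_
            rw [one_div (((M + 1 : ℕ) : ℝ) ^ q), ← Real.inv_rpow (by positivity)]
            apply Real.rpow_le_rpow (by positivity) _ (by linarith)
            apply inv_anti₀ (by positivity)
            push_cast
            have : (1 / (L:ℝ)) ^ 2 * (L ^ 2 * M + x) = M + (1 / (L:ℝ)) ^ 2 * x := by
              field_simp
            rw [this]
            have : 0 ≤ (1 / (L:ℝ)) ^ 2 * x := by positivity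
            linarith
        _ = _ := by simp
  obtain ⟨M, hM⟩ := T.exists_nat_subset_range
  calc _ ≤ ∑ n ∈ Finset.range (L ^ 2 * M), ((1 + (1 / (L:ℝ)) ^ 2 * n)⁻¹) ^ q := by
        apply Finset.sum_le_sum_of_subset_of_nonneg
        · refine hM.trans (Finset.range_mono ?_)
          exact Nat.le_mul_of_pos_left _ (by positivity)
        · intros; positivity
    _ ≤ _ := hind M
    _ ≤ _ := by
      gcongr
      exact hs.sum_le_tsum _ (fun _ _ => by positivity)

lemma aux_seq (d : ℕ) (hd : 2 ≤ d) (k : ℝ) (hk : 0 < k) (hkd : k < d) (a : ℕ → ℝ)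
    (ha : ∀ n, 0 ≤ a n) (hs : Summable (fun n => a n ^ (2 * d / k))) (ε : ℝ) (hε : 0 < ε) :
    ∃ L₀ : ℕ, ∀ L : ℕ, L₀ ≤ L → ∀ T : Finset ℕ,
      ∑ n ∈ T, a n ^ 2 * (1 + (1 / (L:ℝ)) ^ 2 * n)⁻¹ ≤ ε * (L:ℝ) ^ ((d:ℝ) - k) := by
  have hdr : (2:ℝ) ≤ d := by exact_mod_cast hd
  have hdk : 0 < (d:ℝ) - k := by linarith
  set q : ℝ := d / (d - k) with hq
  have hq1 : 1 < q := by rw [hq, lt_div_iff₀ hdk]; linarith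
  set p' : ℝ := d / k with hp'
  have hconj : p'.HolderConjugate q := by
    rw [Real.holderConjugate_iff]
    refine ⟨by rw [hp', lt_div_iff₀ hk]; linarith, ?_⟩
    rw [hp', hq]; field_simp; ring
  set C := ∑' m : ℕ, (1 / ((m + 1 : ℕ) : ℝ) ^ q) with hC
  have hC0 : 0 ≤ C := tsum_nonneg fun _ => by positivity
  -- choose η
  obtain ⟨η, hη, hηε⟩ : ∃ η : ℝ, 0 < η ∧ η ^ (1 / p') * C ^ (1 / q) ≤ ε / 2 := by
    refine ⟨(ε / 2 / (C ^ (1/q) + 1)) ^ p', by positivity, ?_⟩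
    rw [one_div p', Real.rpow_rpow_inv (by positivity) hconj.pos.ne']
    rw [div_mul_eq_mul_div, div_le_iff₀ (by positivity)]
    have : 0 ≤ C ^ (1/q) := by positivity
    nlinarith
  obtain ⟨s, hsT⟩ := summable_iff_vanishing_norm.1 hs η hη
  set K := ∑ n ∈ s, a n ^ 2 with hK
  have hlim : Tendsto (fun L : ℕ => ε / 2 * (L:ℝ) ^ ((d:ℝ) - k)) atTop atTop :=
    Tendsto.const_mul_atTop (by positivity) ((tendsto_rpow_atTop hdk).comp tendsto_natCast_atTop_atTop)
  obtain ⟨L₀, hL₀⟩ := eventually_atTop.1 (hlim.eventually_ge_atTop K)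
  refine ⟨L₀ + 1, fun L hL T => ?_⟩
  have hLpos : 0 < L := by omega
  have hL1 : (1:ℝ) ≤ L := by exact_mod_cast hLpos
  have h1 : ∑ n ∈ T ∩ s, a n ^ 2 * (1 + (1 / (L:ℝ)) ^ 2 * n)⁻¹ ≤ K := by
    calc _ ≤ ∑ n ∈ T ∩ s, a n ^ 2 := by
          refine Finset.sum_le_sum fun n _ => ?_
          refine mul_le_of_le_one_right (by positivity) (inv_le_one_of_one_le₀ ?_)
          have : 0 ≤ (1 / (L:ℝ)) ^ 2 * n := by positivity
          linarith
      _ ≤ _ := Finset.sum_le_sum_of_subset_of_nonneg Finset.inter_subset_right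
          (fun _ _ _ => by positivity)
  have h2 : ∑ n ∈ T \ s, a n ^ 2 * (1 + (1 / (L:ℝ)) ^ 2 * n)⁻¹ ≤ ε / 2 * (L:ℝ) ^ ((d:ℝ) - k) := by
    have hH := Real.inner_le_Lp_mul_Lq_of_nonneg (T \ s) hconj (f := fun n => a n ^ 2)
      (g := fun n => (1 + (1 / (L:ℝ)) ^ 2 * n)⁻¹) (fun _ _ => by positivity) (fun _ _ => by positivity)
    refine hH.trans ?_
    have e1 : ∑ n ∈ T \ s, (a n ^ 2) ^ p' ≤ η := by
      have := hsT (T \ s) Finset.sdiff_disjoint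
      refine le_trans (le_of_eq ?_) ((le_abs_self _).trans this.le)
      refine Finset.sum_congr rfl fun n _ => ?_
      rw [← Real.rpow_natCast, ← Real.rpow_mul (ha n)]
      congr 1; rw [hp']; push_cast; ring
    have e2 := aux_block q hq1 L hLpos (T \ s)
    calc _ ≤ η ^ (1 / p') * ((L:ℝ) ^ 2 * C) ^ (1 / q) := by
          have := hconj.pos; have := hconj.symm.pos
          gcongr
      _ = (η ^ (1 / p') * C ^ (1 / q)) * ((L:ℝ) ^ 2) ^ (1 / q) := by
          rw [Real.mul_rpow (by positivity) hC0]; ring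
      _ ≤ ε / 2 * (L:ℝ) ^ ((d:ℝ) - k) := by
          gcongr
          rw [← Real.rpow_natCast, ← Real.rpow_mul (by positivity)]
          apply Real.rpow_le_rpow_of_exponent_le hL1
          rw [hq, one_div_div]; push_cast
          rw [mul_div_assoc', div_le_iff₀ (by linarith)]
          nlinarith
  rw [← Finset.sum_inter_add_sum_sdiff T s]
  have := hL₀ L (by omega)
  linarith

lemma aux_char_add {d : ℕ} (j : Fin d → ℤ) (x y : Torus d) :
    torusChar j (x + y) = torusChar j x * torusChar j y := by
  unfold torusChar
  rw [← Finset.prod_mul_distrib]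
  refine Finset.prod_congr rfl fun m _ => ?_
  simp [fourier_apply, AddCircle.toCircle_add]

lemma aux_char_cont {d : ℕ} (j : Fin d → ℤ) : Continuous (torusChar j) := by
  unfold torusChar; fun_prop

lemma aux_char_norm {d : ℕ} (j : Fin d → ℤ) (x : Torus d) : ‖torusChar j x‖ = 1 := by
  unfold torusChar
  rw [norm_prod]
  exact Finset.prod_eq_one fun m _ => by rw [fourier_apply]; exact Circle.norm_coe _

lemma aux_meas {d : ℕ} (m : Measure (Torus d)) [IsFiniteMeasure m] (δ : ℝ) :
    Measurable (fun x : Torus d => m.real (closedBall x δ)) := by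
  have hS : MeasurableSet {z : Torus d × Torus d | dist z.2 z.1 ≤ δ} :=
    (isClosed_le (by fun_prop) (by fun_prop)).measurableSet
  exact (measurable_measure_prodMk_left (ν := m) hS).ennreal_toReal

lemma aux_fub {d : ℕ} (m : Measure (Torus d)) [IsFiniteMeasure m] (δ : ℝ) (j : Fin d → ℤ) :
    ∫ x, starRingEnd ℂ (torusChar j x) * (m.real (closedBall x δ) : ℂ)
      = (∫ y, starRingEnd ℂ (torusChar j y) ∂m) *
        ∫ x in closedBall (0 : Torus d) δ, starRingEnd ℂ (torusChar j x) := by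
  set S : Set (Torus d × Torus d) := {z | dist z.2 z.1 ≤ δ} with hSd
  have hS : MeasurableSet S :=
    (isClosed_le (by fun_prop) (by fun_prop)).measurableSet
  have hc : Continuous (fun z : Torus d × Torus d => starRingEnd ℂ (torusChar j z.1)) :=
    Complex.continuous_conj.comp ((aux_char_cont j).comp continuous_fst)
  have hint : Integrable (Function.uncurry fun x y : Torus d =>
      S.indicator (fun z => starRingEnd ℂ (torusChar j z.1)) (x, y)) (volume.prod m) := by
    change Integrable (S.indicator (fun z => starRingEnd ℂ (torusChar j z.1))) _
    refine Integrable.indicator ?_ hS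
    refine Integrable.of_bound hc.aestronglyMeasurable 1 (ae_of_all _ fun z => ?_)
    simp [aux_char_norm]
  have h1 : ∀ x : Torus d, starRingEnd ℂ (torusChar j x) * (m.real (closedBall x δ) : ℂ)
      = ∫ y, S.indicator (fun z => starRingEnd ℂ (torusChar j z.1)) (x, y) ∂m := by
    intro x
    have : ∀ y, S.indicator (fun z => starRingEnd ℂ (torusChar j z.1)) (x, y)
        = (closedBall x δ).indicator (fun _ => starRingEnd ℂ (torusChar j x)) y := fun y => rfl
    simp_rw [this]
    rw [integral_indicator measurableSet_closedBall, setIntegral_const, mul_comm]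
    simp
  simp_rw [h1]
  rw [integral_integral_swap hint, ← integral_mul_const]
  congr 1
  funext y
  rw [← integral_add_right_eq_self _ y, ← integral_indicator measurableSet_closedBall,
    ← integral_const_mul]
  congr 1
  funext x
  by_cases hx : x ∈ closedBall (0 : Torus d) δ
  · have : (x + y, y) ∈ S := by
      simpa [hSd, dist_eq_norm] using hx
    rw [Set.indicator_of_mem hx, Set.indicator_of_mem this, aux_char_add, map_mul, mul_comm]
  · have : (x + y, y) ∉ S := by
      simpa [hSd, dist_eq_norm] using hx
    rw [Set.indicator_of_notMem hx, Set.indicator_of_notMem this, mul_zero]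

lemma aux_box {d : ℕ} (δ : ℝ) (hδ : 0 < δ) (hδ2 : δ < 1 / 2) (j : Fin d → ℤ) :
    ∫ x in closedBall (0 : Torus d) δ, starRingEnd ℂ (torusChar j x)
      = (((2 * δ) ^ d * ∏ m, Real.sinc (2 * π * j m * δ) : ℝ) : ℂ) := by
  rw [closedBall_pi _ hδ.le, volume_pi, Measure.restrict_pi_pi]
  simp only [torusChar, map_prod]
  rw [integral_fintype_prod_eq_prod (𝕜 := ℂ) (fun i (t : AddCircle (1:ℝ)) => starRingEnd ℂ (fourier (j i) t : ℂ))]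
  have := fun i => aux_circ δ hδ hδ2 (j i)
  simp only [Pi.zero_apply, this]
  push_cast
  rw [Finset.prod_mul_distrib]
  simp

lemma aux_sinc (x : ℝ) : Real.sinc x ^ 2 * (1 + x ^ 2) ≤ 2 := by
  by_cases hx : x = 0
  · subst hx; simp
  have h1 := Real.abs_sinc_le_one x
  have h2 : Real.sinc x ^ 2 ≤ 1 := by rw [← sq_abs]; nlinarith [abs_nonneg (Real.sinc x)]
  have h3 : Real.sinc x ^ 2 * x ^ 2 ≤ 1 := by
    rw [Real.sinc_of_ne_zero hx, ← mul_pow, div_mul_cancel₀ _ hx]; exact Real.sin_sq_le_one x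
  linarith

lemma aux_mult {d : ℕ} (hd : 1 ≤ d) (δ : ℝ) (j : Fin d → ℤ) :
    (∏ m, Real.sinc (2 * π * j m * δ)) ^ 2 ≤ 2 * d * (1 + δ ^ 2 * ∑ m, (j m : ℝ) ^ 2)⁻¹ := by
  have hS : 0 ≤ ∑ m, (j m : ℝ) ^ 2 := Finset.sum_nonneg fun _ _ => by positivity
  rw [← div_eq_mul_inv, le_div_iff₀ (by positivity)]
  set P := (∏ m, Real.sinc (2 * π * j m * δ)) ^ 2 with hP
  have hle : ∀ i, P ≤ Real.sinc (2 * π * j i * δ) ^ 2 := by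
    intro i
    rw [hP, ← Finset.prod_pow, ← Finset.mul_prod_erase _ _ (Finset.mem_univ i)]
    refine mul_le_of_le_one_right (by positivity) (Finset.prod_le_one (fun _ _ => by positivity) ?_)
    intro m _
    rw [← sq_abs]
    exact pow_le_one₀ (abs_nonneg _) (Real.abs_sinc_le_one _)
  have hP0 : 0 ≤ P := by positivity
  have h1 : ∀ i, P * (1 + δ ^ 2 * (j i : ℝ) ^ 2) ≤ 2 := by
    intro i
    refine le_trans ?_ (aux_sinc (2 * π * j i * δ))
    have hpi : (1:ℝ) ≤ (2 * π) ^ 2 := by nlinarith [Real.pi_gt_three]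
    have h0 : 0 ≤ δ ^ 2 * (j i : ℝ) ^ 2 := by positivity
    have : (2 * π * j i * δ) ^ 2 = (2 * π) ^ 2 * (δ ^ 2 * (j i : ℝ) ^ 2) := by ring
    rw [this]
    exact mul_le_mul (hle i) (by nlinarith) (by positivity) (by positivity)
  have h2 : ∑ i, P * (1 + δ ^ 2 * (j i : ℝ) ^ 2) ≤ ∑ i : Fin d, (2:ℝ) := Finset.sum_le_sum fun i _ => h1 i
  rw [← Finset.mul_sum, Finset.sum_add_distrib, ← Finset.mul_sum] at h2
  simp at h2
  have hd' : (1:ℝ) ≤ d := by exact_mod_cast hd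
  nlinarith

lemma aux_supp {X : Type*} [TopologicalSpace X] [MeasurableSpace X] [OpensMeasurableSpace X]
    (μ : ComplexMeasure X) (K : Set X) (hK : IsCompact K) (hKm : MeasurableSet K)
    (h : ∀ x ∈ K, x ∉ msupport μ) : μ K = 0 := by
  have : ∃ U, IsOpen U ∧ K ⊆ U ∧ ∀ A, MeasurableSet A → A ⊆ U → μ A = 0 := by
    refine hK.induction_on (p := fun s => ∃ U, IsOpen U ∧ s ⊆ U ∧ ∀ A, MeasurableSet A → A ⊆ U → μ A = 0)
      ?_ ?_ ?_ ?_
    · refine ⟨∅, isOpen_empty, subset_rfl, fun A _ hA => ?_⟩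
      rw [Set.subset_empty_iff.1 hA]; simp
    · rintro s t hst ⟨U, h1, h2, h3⟩
      exact ⟨U, h1, hst.trans h2, h3⟩
    · rintro s t ⟨U, h1, h2, h3⟩ ⟨V, g1, g2, g3⟩
      refine ⟨U ∪ V, h1.union g1, Set.union_subset_union h2 g2, fun A hA hAU => ?_⟩
      have e : A = (A ∩ U) ∪ (A \ U) := (Set.inter_union_sdiff A U).symm
      rw [e, VectorMeasure.of_union (Set.disjoint_sdiff_right.mono_left Set.inter_subset_right)
        (hA.inter h1.measurableSet) (hA.diff h1.measurableSet),
        h3 _ (hA.inter h1.measurableSet) Set.inter_subset_right,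
        g3 _ (hA.diff h1.measurableSet) (by
          intro x hx; exact (hAU hx.1).resolve_left hx.2), add_zero]
    · intro x hx
      have := h x hx
      simp only [msupport, Set.mem_ofPred_eq] at this
      push Not at this
      obtain ⟨U, hU, hxU, hA⟩ := this
      exact ⟨U, mem_nhdsWithin_of_mem_nhds (hU.mem_nhds hxU), U, hU, subset_rfl,
        fun A h1 h2 => hA A h1 h2⟩
  obtain ⟨U, _, h2, h3⟩ := this
  exact h3 K hKm h2

lemma aux_conj_int {d : ℕ} (m : Measure (Torus d)) (j : Fin d → ℤ) :
    ∫ x, starRingEnd ℂ (torusChar (-j) x) ∂m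
      = starRingEnd ℂ (∫ x, starRingEnd ℂ (torusChar j x) ∂m) := by
  rw [← integral_conj]
  congr 1; funext x
  simp [torusChar, fourier_neg]

lemma aux_unique {d : ℕ} (P P' : Measure (Torus d)) [IsFiniteMeasure P] [IsFiniteMeasure P']
    (h : ∀ j : Fin d → ℤ, ∫ x, starRingEnd ℂ (torusChar j x) ∂P
      = ∫ x, starRingEnd ℂ (torusChar j x) ∂P') : P = P' := by
  apply ext_of_forall_mem_subalgebra_integral_eq_of_pseudoEMetric_complete_countable (𝕜 := ℂ)
    (A := (UnitAddTorus.mFourierSubalgebra (Fin d)).comap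
      (BoundedContinuousFunction.toContinuousMapStarₐ ℂ))
  · intro x y hxy
    obtain ⟨_, ⟨f, hf, rfl⟩, hne⟩ := UnitAddTorus.mFourierSubalgebra_separatesPoints (d := Fin d) hxy
    refine ⟨_, ⟨f, ?_, rfl⟩, hne⟩
    exact ⟨BoundedContinuousFunction.mkOfCompact f, hf, rfl⟩
  · intro g hg
    have hg' : (g : C(Torus d, ℂ)) ∈ Submodule.span ℂ (Set.range (UnitAddTorus.mFourier (d := Fin d))) := by
      rw [← UnitAddTorus.mFourierSubalgebra_coe]; exact hg
    change ∫ x, (g : C(Torus d, ℂ)) x ∂P = ∫ x, (g : C(Torus d, ℂ)) x ∂P'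
    have hi : ∀ (Q : Measure (Torus d)) [IsFiniteMeasure Q] (f : C(Torus d, ℂ)), Integrable f Q := by
      intro Q _ f
      exact f.continuous.integrable_of_hasCompactSupport (HasCompactSupport.of_compactSpace _)
    generalize (g : C(Torus d, ℂ)) = f at hg'
    induction hg' using Submodule.span_induction with
    | mem f hf =>
      obtain ⟨j, rfl⟩ := hf
      have := h (-j)
      simpa [torusChar, fourier_neg] using! this
    | zero => simp
    | add f1 f2 _ _ h1 h2 =>
      simp only [ContinuousMap.add_apply]
      rw [integral_add (hi P f1) (hi P f2), integral_add (hi P' f1) (hi P' f2), h1, h2]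
    | smul c f _ h1 =>
      simp only [ContinuousMap.smul_apply]
      rw [integral_smul, integral_smul, h1]

lemma aux_zero {d : ℕ} (μ : ComplexMeasure (Torus d)) (h : ∀ j, muHat μ j = 0) : μ = 0 := by
  have key : ∀ j : Fin d → ℤ,
      (∫ x, starRingEnd ℂ (torusChar j x) ∂((ComplexMeasure.re μ).toJordanDecomposition.posPart)
        = ∫ x, starRingEnd ℂ (torusChar j x) ∂((ComplexMeasure.re μ).toJordanDecomposition.negPart)) ∧
      (∫ x, starRingEnd ℂ (torusChar j x) ∂((ComplexMeasure.im μ).toJordanDecomposition.posPart)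
        = ∫ x, starRingEnd ℂ (torusChar j x) ∂((ComplexMeasure.im μ).toJordanDecomposition.negPart)) := by
    intro j
    have h1 := h j
    have h2 := congrArg (starRingEnd ℂ) (h (-j))
    simp only [muHat, cIntegral, aux_conj_int] at h1 h2
    simp only [map_add, map_sub, map_mul, Complex.conj_conj, Complex.conj_I, map_zero] at h2
    constructor
    · linear_combination (h1 + h2) / 2
    · linear_combination (-I) * (h1 - h2) / 2 + (
        (∫ x, starRingEnd ℂ (torusChar j x) ∂((ComplexMeasure.im μ).toJordanDecomposition.posPart))
        - ∫ x, starRingEnd ℂ (torusChar j x) ∂((ComplexMeasure.im μ).toJordanDecomposition.negPart)) * I_sq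
  have e1 := aux_unique _ _ fun j => (key j).1
  have e2 := aux_unique _ _ fun j => (key j).2
  ext A hA
  have r : (ComplexMeasure.re μ) A = 0 := by
    rw [SignedMeasure.apply_eq_posPart_real_sub_negPart_real _ hA, e1, sub_self]
  have i : (ComplexMeasure.im μ) A = 0 := by
    rw [SignedMeasure.apply_eq_posPart_real_sub_negPart_real _ hA, e2, sub_self]
  exact Complex.ext r i

lemma aux_apply {X : Type*} [MeasurableSpace X] (μ : ComplexMeasure X) (A : Set X) (hA : MeasurableSet A) :
    μ A = (((ComplexMeasure.re μ).toJordanDecomposition.posPart.real A : ℂ)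
      - ((ComplexMeasure.re μ).toJordanDecomposition.negPart.real A : ℂ))
      + I * (((ComplexMeasure.im μ).toJordanDecomposition.posPart.real A : ℂ)
      - ((ComplexMeasure.im μ).toJordanDecomposition.negPart.real A : ℂ)) := by
  have r := SignedMeasure.apply_eq_posPart_real_sub_negPart_real (ComplexMeasure.re μ) hA
  have i := SignedMeasure.apply_eq_posPart_real_sub_negPart_real (ComplexMeasure.im μ) hA
  rw [← Complex.ofReal_sub, ← Complex.ofReal_sub, ← r, ← i, mul_comm]
  exact (Complex.re_add_im (μ A)).symm

lemma aux_Fmeas {d : ℕ} (μ : ComplexMeasure (Torus d)) (δ : ℝ) :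
    Measurable (fun x => μ (closedBall x δ)) := by
  simp_rw [fun x => aux_apply μ (closedBall x δ) measurableSet_closedBall]
  have := fun (m : Measure (Torus d)) (_ : IsFiniteMeasure m) =>
    Complex.measurable_ofReal.comp (aux_meas m δ)
  exact ((this _ inferInstance).sub (this _ inferInstance)).add
    (((this _ inferInstance).sub (this _ inferInstance)).const_mul _)

lemma aux_Fbdd {d : ℕ} (μ : ComplexMeasure (Torus d)) (δ : ℝ) :
    ∃ C, ∀ x, ‖μ (closedBall x δ)‖ ≤ C := by
  have hb := fun (m : Measure (Torus d)) (_ : IsFiniteMeasure m) (x : Torus d) =>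
    (show ‖(m.real (closedBall x δ) : ℂ)‖ ≤ m.real Set.univ by
      rw [Complex.norm_real, Real.norm_of_nonneg measureReal_nonneg]
      exact measureReal_mono (Set.subset_univ _))
  refine ⟨((ComplexMeasure.re μ).toJordanDecomposition.posPart.real Set.univ
    + (ComplexMeasure.re μ).toJordanDecomposition.negPart.real Set.univ)
    + ((ComplexMeasure.im μ).toJordanDecomposition.posPart.real Set.univ
    + (ComplexMeasure.im μ).toJordanDecomposition.negPart.real Set.univ), fun x => ?_⟩
  rw [aux_apply μ (closedBall x δ) measurableSet_closedBall]
  refine (norm_add_le _ _).trans (add_le_add ((norm_sub_le _ _).trans (add_le_add (hb _ inferInstance x) (hb _ inferInstance x))) ?_)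
  rw [norm_mul, Complex.norm_I, one_mul]
  exact (norm_sub_le _ _).trans (add_le_add (hb _ inferInstance x) (hb _ inferInstance x))

lemma aux_Fhat {d : ℕ} (μ : ComplexMeasure (Torus d)) (δ : ℝ) (hδ : 0 < δ) (hδ2 : δ < 1 / 2)
    (j : Fin d → ℤ) :
    ∫ x, starRingEnd ℂ (torusChar j x) * μ (closedBall x δ)
      = muHat μ j * (((2 * δ) ^ d * ∏ m, Real.sinc (2 * π * j m * δ) : ℝ) : ℂ) := by
  simp_rw [fun x => aux_apply μ (closedBall x δ) measurableSet_closedBall]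
  have hi := fun (m : Measure (Torus d)) (_ : IsFiniteMeasure m) =>
    (show Integrable (fun x => starRingEnd ℂ (torusChar j x) * (m.real (closedBall x δ) : ℂ)) volume by
      refine Integrable.of_bound (C := m.real Set.univ) ?_ (ae_of_all _ fun x => ?_)
      · exact ((Complex.continuous_conj.comp (aux_char_cont j)).measurable.mul
          (Complex.measurable_ofReal.comp (aux_meas m δ))).aestronglyMeasurable
      · rw [norm_mul, RCLike.norm_conj, aux_char_norm, one_mul, Complex.norm_real,
          Real.norm_of_nonneg measureReal_nonneg]
        exact measureReal_mono (Set.subset_univ _))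
  rw [← aux_box δ hδ hδ2, muHat, cIntegral]
  simp only [mul_add, mul_sub, mul_left_comm _ I]
  rw [integral_add, integral_sub, integral_sub, integral_const_mul, integral_const_mul,
    aux_fub, aux_fub, aux_fub, aux_fub]
  · ring
  all_goals first
    | exact hi _ inferInstance
    | exact (hi _ inferInstance).const_mul _
    | exact (hi _ inferInstance).sub (hi _ inferInstance)
    | exact ((hi _ inferInstance).const_mul _).sub ((hi _ inferInstance).const_mul _)

lemma aux_acoeff {d : ℕ} (μ : ComplexMeasure (Torus d)) (n : ℕ) (s : Finset (Fin d → ℤ))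
    (hs : ∀ j ∈ s, ∑ m, (j m) ^ 2 = (n : ℤ)) :
    ∑ j ∈ s, ‖muHat μ j‖ ^ 2 ≤ aCoeff μ n ^ 2 := by
  have hfin : Finite {j : Fin d → ℤ // (∑ m, (j m) ^ 2) = (n : ℤ)} := by
    refine Set.Finite.subset (Set.finite_Icc (fun _ => -(n:ℤ)) (fun _ => (n:ℤ))) ?_
    intro j hj
    have hj' : ∑ m, (j m) ^ 2 = (n : ℤ) := hj
    have : ∀ i, (j i) ^ 2 ≤ (n:ℤ) := fun i => by
      rw [← hj']; exact Finset.single_le_sum (f := fun m => (j m) ^ 2) (fun _ _ => by positivity) (Finset.mem_univ i)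
    constructor <;> intro i <;> have := this i <;> dsimp only <;> nlinarith
  rw [aCoeff, Real.sq_sqrt (tsum_nonneg fun _ => by positivity)]
  have hsm : Summable (fun j : {j : Fin d → ℤ // (∑ m, (j m) ^ 2) = (n : ℤ)} =>
      ‖muHat μ (j : Fin d → ℤ)‖ ^ 2) := Summable.of_finite
  refine le_trans (le_of_eq ?_) (hsm.sum_le_tsum
    (s.subtype (fun j : Fin d → ℤ => (∑ m, (j m) ^ 2) = (n : ℤ))) (fun _ _ => by positivity))
  rw [Finset.sum_subtype_eq_sum_filter (f := fun j => ‖muHat μ j‖ ^ 2), Finset.filter_true_of_mem hs]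

lemma aux_main {d : ℕ} (hd : 1 ≤ d) (μ : ComplexMeasure (Torus d)) (E : Set (Torus d))
    (hsupp : msupport μ ⊆ E) (δ : ℝ) (hδ : 0 < δ) (hδ2 : δ < 1 / 2) (B : ℝ)
    (hB : ∀ T : Finset ℕ, ∑ n ∈ T, aCoeff μ n ^ 2 * (1 + δ ^ 2 * n)⁻¹ ≤ B) (j₀ : Fin d → ℤ) :
    ‖muHat μ j₀‖ ^ 2 * (∏ m, Real.sinc (2 * π * j₀ m * δ)) ^ 2
      ≤ (volume : Measure (Torus d)).real (thickening (2 * δ) E) * (2 * d * B) := by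
  set F : Torus d → ℂ := fun x => μ (closedBall x δ) with hF
  set V : ℝ := (2 * δ) ^ d with hV
  have hVpos : 0 < V := by positivity
  set S := thickening (2 * δ) E with hS
  have hSm : MeasurableSet S := isOpen_thickening.measurableSet
  have hFm : Measurable F := aux_Fmeas μ δ
  obtain ⟨C, hC⟩ := aux_Fbdd μ δ
  have hF0 : ∀ x, x ∉ S → F x = 0 := by
    intro x hx
    refine aux_supp μ _ (isCompact_closedBall x δ) measurableSet_closedBall fun y hy hy2 => hx ?_
    refine mem_thickening_iff.2 ⟨y, hsupp hy2, ?_⟩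
    rw [dist_comm]
    have := mem_closedBall.1 hy
    linarith
  have hLp : MemLp F 2 (volume : Measure (Torus d)) :=
    MemLp.of_bound hFm.aestronglyMeasurable C (ae_of_all _ hC)
  have hP := aux_pars F hLp
  -- L2 bound
  have hI : ∫ x, ‖F x‖ ^ 2 ≤ V ^ 2 * (2 * d * B) := by
    refine hasSum_le_of_sum_le hP fun s => ?_
    calc _ ≤ ∑ j ∈ s, V ^ 2 * (2 * d) *
          (‖muHat μ j‖ ^ 2 * (1 + δ ^ 2 * ((∑ m, (j m) ^ 2).toNat : ℕ))⁻¹) := by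
          refine Finset.sum_le_sum fun j _ => ?_
          have e : (((∑ m, (j m) ^ 2).toNat : ℕ) : ℝ) = ∑ m, (j m : ℝ) ^ 2 := by
            have : (((∑ m, (j m) ^ 2).toNat : ℕ) : ℤ) = ∑ m, (j m) ^ 2 :=
              Int.toNat_of_nonneg (Finset.sum_nonneg fun _ _ => by positivity)
            have := congrArg (Int.cast (R := ℝ)) this
            push_cast at this
            exact_mod_cast this
          rw [e, hF, aux_Fhat μ δ hδ hδ2, norm_mul, Complex.norm_real, mul_pow, Real.norm_eq_abs,
            sq_abs, mul_pow, ← hV]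
          have := aux_mult hd δ j
          calc _ = V ^ 2 * ‖muHat μ j‖ ^ 2 * (∏ m, Real.sinc (2 * π * j m * δ)) ^ 2 := by ring
            _ ≤ V ^ 2 * ‖muHat μ j‖ ^ 2 * (2 * d * (1 + δ ^ 2 * ∑ m, (j m : ℝ) ^ 2)⁻¹) := by gcongr
            _ = _ := by ring
      _ = V ^ 2 * (2 * d) * ∑ j ∈ s, (‖muHat μ j‖ ^ 2 * (1 + δ ^ 2 * ((∑ m, (j m) ^ 2).toNat : ℕ))⁻¹) := by
          rw [Finset.mul_sum]
      _ ≤ V ^ 2 * (2 * d) * B := by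
          gcongr
          refine le_trans ?_ (hB (s.image fun j => (∑ m, (j m) ^ 2).toNat))
          rw [← Finset.sum_fiberwise_of_maps_to (t := s.image fun j => (∑ m, (j m) ^ 2).toNat)
            (g := fun j => (∑ m, (j m) ^ 2).toNat) (fun j hj => Finset.mem_image_of_mem _ hj)]
          refine Finset.sum_le_sum fun n _ => ?_
          refine le_trans (le_of_eq ?_) (mul_le_mul_of_nonneg_right
            (aux_acoeff μ n (s.filter fun j => (∑ m, (j m) ^ 2).toNat = n) ?_) (by positivity))
          · rw [Finset.sum_mul]
            refine Finset.sum_congr rfl fun j hj => ?_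
            rw [(Finset.mem_filter.1 hj).2]
          · intro j hj
            rw [← (Finset.mem_filter.1 hj).2]
            exact (Int.toNat_of_nonneg (Finset.sum_nonneg fun _ _ => by positivity)).symm
      _ = _ := by ring
  -- Cauchy-Schwarz
  have hi1 : Integrable (fun x => ‖F x‖) volume :=
    Integrable.of_bound hFm.norm.aestronglyMeasurable C (ae_of_all _ fun x => by simpa using hC x)
  have hi2 : Integrable (fun x => ‖F x‖ ^ 2) volume := hLp.integrable_norm_pow (by norm_num)
  have hi3 : Integrable (S.indicator (fun _ => (1:ℝ))) (volume : Measure (Torus d)) :=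
    (integrable_const _).indicator hSm
  have hCS : (∫ x, ‖F x‖) ^ 2 ≤ volume.real S * ∫ x, ‖F x‖ ^ 2 := by
    have hq : ∀ t : ℝ, 0 ≤ volume.real S * (t * t) + (-2 * ∫ x, ‖F x‖) * t + ∫ x, ‖F x‖ ^ 2 := by
      intro t
      have : 0 ≤ ∫ x, (t * t * S.indicator (fun _ => (1:ℝ)) x + (-2 * t) * ‖F x‖ + ‖F x‖ ^ 2) := by
        refine integral_nonneg fun x => ?_
        by_cases hx : x ∈ S
        · simp only [Pi.zero_apply, Set.indicator_of_mem hx]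
          nlinarith [sq_nonneg (t - ‖F x‖)]
        · simp [Set.indicator_of_notMem hx, hF0 x hx]
      have hi4 : Integrable (fun x => t * t * S.indicator (fun _ => (1:ℝ)) x + (-2 * t) * ‖F x‖)
          volume := (hi3.const_mul _).add (hi1.const_mul _)
      rw [integral_add hi4 hi2,
        integral_add (hi3.const_mul _) (hi1.const_mul _), integral_const_mul, integral_const_mul,
        integral_indicator hSm, setIntegral_const] at this
      simp only [smul_eq_mul, mul_one] at this
      linarith
    have := discrim_le_zero hq
    rw [discrim] at this
    nlinarith
  have hM : ‖∫ x, starRingEnd ℂ (torusChar j₀ x) * F x‖ ≤ ∫ x, ‖F x‖ := by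
    refine (norm_integral_le_integral_norm _).trans (le_of_eq ?_)
    congr 1; funext x
    rw [norm_mul, RCLike.norm_conj, aux_char_norm, one_mul]
  rw [hF, aux_Fhat μ δ hδ hδ2, norm_mul, Complex.norm_real, Real.norm_eq_abs, ← hV] at hM
  have hM2 := pow_le_pow_left₀ (by positivity) hM 2
  rw [mul_pow, sq_abs, mul_pow] at hM2
  have hfin := hM2.trans (hCS.trans (mul_le_mul_of_nonneg_left hI measureReal_nonneg))
  have : V ^ 2 * (‖muHat μ j₀‖ ^ 2 * (∏ m, Real.sinc (2 * π * j₀ m * δ)) ^ 2)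
      ≤ V ^ 2 * (volume.real S * (2 * d * B)) := by linarith
  exact le_of_mul_le_mul_left this (by positivity)

/-- **Spectral synthesis for thinly supported measures on the torus**
(Theorem 1.1 together with Remark 1.2, case `M = 𝕋^d`): if a finite complex Borel
measure `μ` on `𝕋^d` is supported in a compact set `E` whose `δ`-neighborhoods
satisfy the volume bound `|E^δ| ≤ C_E δ^{d-k}`, and if `Σ_n a_n(μ)^p < ∞` for some
`2 ≤ p ≤ 2d/k`, then `μ = 0`. -/
theorem spectral_synthesis_torus
    (d : ℕ) (hd : 1 ≤ d) (k : ℝ) (hk1 : 1 ≤ k) (hkd : k < d)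
    (E : Set (Torus d)) (hE : IsCompact E)
    (C_E δ₀ : ℝ) (hCE : 0 < C_E) (hδ₀ : 0 < δ₀) (hδ₀1 : δ₀ ≤ 1)
    (hvol : ∀ δ : ℝ, 0 < δ → δ ≤ δ₀ →
      volume (Metric.thickening δ E) ≤ ENNReal.ofReal (C_E * δ ^ ((d : ℝ) - k)))
    (μ : ComplexMeasure (Torus d))
    (hsupp : msupport μ ⊆ E)
    (p : ℝ) (hp2 : 2 ≤ p) (hp : p ≤ 2 * d / k)
    (hsum : Summable (fun n : ℕ => aCoeff μ n ^ p)) :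
    μ = 0 := by
  have hd2 : 2 ≤ d := by
    have h1 : (1:ℝ) < d := lt_of_le_of_lt hk1 hkd
    have : 1 < d := by exact_mod_cast h1
    omega
  have hk0 : 0 < k := by linarith
  have ha : ∀ n, 0 ≤ aCoeff μ n := fun n => Real.sqrt_nonneg _
  have hsum' : Summable (fun n : ℕ => aCoeff μ n ^ (2 * d / k)) := by
    refine Summable.of_norm_bounded_eventually_nat hsum ?_
    have h0 := hsum.tendsto_atTop_zero.eventually_le_const (zero_lt_one)
    filter_upwards [h0] with n hn
    have hle : aCoeff μ n ≤ 1 := by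
      by_contra hcon
      push Not at hcon
      exact absurd hn (not_le.2 (Real.one_lt_rpow hcon (by linarith)))
    rw [Real.norm_of_nonneg (Real.rpow_nonneg (ha n) _)]
    exact Real.rpow_le_rpow_of_exponent_ge' (ha n) hle (by linarith) hp
  refine aux_zero μ fun j₀ => ?_
  have hdk : 0 < (d:ℝ) - k := by linarith
  have main : ∀ ε : ℝ, 0 < ε → ‖muHat μ j₀‖ ^ 2 ≤ C_E * 2 ^ ((d:ℝ) - k) * (2 * d) * ε := by
    intro ε hε
    obtain ⟨L₀, hL₀⟩ := aux_seq d hd2 k hk0 hkd (aCoeff μ) ha hsum' ε hε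
    have hlim0 : Tendsto (fun L : ℕ => 1 / (L:ℝ)) atTop (nhds 0) := tendsto_one_div_atTop_nhds_zero_nat
    have hcont : Continuous (fun δ : ℝ => ‖muHat μ j₀‖ ^ 2 * (∏ m, Real.sinc (2 * π * j₀ m * δ)) ^ 2) := by
      have := Real.continuous_sinc
      fun_prop
    have hlim := (hcont.tendsto 0).comp hlim0
    simp only [mul_zero, Real.sinc_zero, Finset.prod_const_one, one_pow, mul_one] at hlim
    refine le_of_tendsto hlim ?_
    have hsmall : ∀ᶠ L : ℕ in atTop, 1 / (L:ℝ) < min (1 / 2) (δ₀ / 2) :=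
      hlim0.eventually_lt_const (by positivity)
    filter_upwards [hsmall, eventually_ge_atTop L₀, eventually_ge_atTop 1] with L h1 h2 h3
    have hLpos : (0:ℝ) < L := by exact_mod_cast h3
    have hδ : 0 < 1 / (L:ℝ) := by positivity
    have h4 := lt_min_iff.1 h1
    have hm := aux_main hd μ E hsupp (1 / (L:ℝ)) hδ h4.1 _ (hL₀ L h2) j₀
    refine hm.trans ?_
    have hv := hvol (2 * (1 / (L:ℝ))) (by positivity) (by linarith [h4.2])
    have hv' : (volume : Measure (Torus d)).real (thickening (2 * (1 / (L:ℝ))) E)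
        ≤ C_E * (2 * (1 / (L:ℝ))) ^ ((d:ℝ) - k) :=
      ENNReal.toReal_le_of_le_ofReal (by positivity) hv
    calc _ ≤ C_E * (2 * (1 / (L:ℝ))) ^ ((d:ℝ) - k) * (2 * d * (ε * (L:ℝ) ^ ((d:ℝ) - k))) := by
          gcongr
      _ = C_E * 2 ^ ((d:ℝ) - k) * (2 * d) * ε * ((1 / (L:ℝ)) ^ ((d:ℝ) - k) * (L:ℝ) ^ ((d:ℝ) - k)) := by
          rw [Real.mul_rpow (by norm_num) hδ.le]; ring
      _ = _ := by
          rw [← Real.mul_rpow hδ.le hLpos.le, one_div_mul_cancel hLpos.ne', Real.one_rpow, mul_one]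
  set K := C_E * 2 ^ ((d:ℝ) - k) * (2 * d) with hK
  have hK0 : 0 ≤ K := by positivity
  have h0 : ‖muHat μ j₀‖ ^ 2 ≤ 0 := by
    refine le_of_forall_pos_le_add fun ε hε => ?_
    refine (main (ε / (K + 1)) (by positivity)).trans ?_
    rw [zero_add, mul_div_assoc', div_le_iff₀ (by positivity)]
    nlinarith
  have := pow_eq_zero_iff (two_ne_zero) |>.1 (le_antisymm h0 (by positivity))
  exact norm_eq_zero.1 this
end
end

section
/- L² multiplier bound on the torus (inequality (2.1) in the proof of Theorem 1.3, case M = 𝕋^d): Let d ≥ 1, let p > 2 be real, and let ψ : ℝ → ℂ be a Schwartz function. Then there exists C > 0, depending only on d, p, ψ, such that for every finite complex Borel measure μ on 𝕋^d and every R ≥ 1, Σ_{j ∈ ℤ^d} |ψ(|j|/R)|² |μ̂(j)|² ≤ C · R^{d(1 − 2/p)} · (Σ_{n ∈ ℕ} a_n(μ)^p)^{2/p}. -/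
open MeasureTheory Complex Filter FourierTransform Metric
open scoped Real

noncomputable section

lemma aux_tsum_pi (d : ℕ) (f : ℤ → ENNReal) :
    ∑' j : Fin d → ℤ, ∏ m, f (j m) = (∑' k, f k) ^ d := by
  induction d with
  | zero => simp
  | succ n ih =>
    rw [← (Fin.consEquiv (fun _ : Fin (n + 1) => ℤ)).tsum_eq, ENNReal.tsum_prod']
    simp only [Fin.consEquiv, Equiv.coe_fn_mk, Fin.prod_univ_succ, Fin.cons_zero, Fin.cons_succ]
    simp_rw [ENNReal.tsum_mul_left]
    rw [ih, ENNReal.tsum_mul_right, pow_succ, mul_comm]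

lemma aux_summable : Summable (fun k : ℤ => 3 / (1 + (k : ℝ) ^ 2)) := by
  have h := (Real.summable_one_div_int_pow (p := 2)).2 (by norm_num)
  refine Summable.of_norm_bounded_eventually (h.mul_left 3) ?_
  have : {(0 : ℤ)}ᶜ ∈ (cofinite : Filter ℤ) := (Set.finite_singleton 0).compl_mem_cofinite
  filter_upwards [this] with k hk
  have hk : (k : ℝ) ≠ 0 := by simpa using hk
  have : 0 < (k : ℝ) ^ 2 := by positivity
  rw [Real.norm_of_nonneg (by positivity), mul_one_div]
  gcongr
  linarith

lemma aux_1d : ∃ A : ℝ, 0 < A ∧ ∀ R : ℝ, 1 ≤ R →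
    ∑' k : ℤ, ENNReal.ofReal (1 / (1 + ((k : ℝ) / R) ^ 2)) ≤ ENNReal.ofReal (A * R) := by
  have hS := aux_summable
  set S := ∑' k : ℤ, 3 / (1 + (k : ℝ) ^ 2) with hSdef
  have hS0 : 0 ≤ S := tsum_nonneg fun k => by positivity
  refine ⟨2 * S + 1, by positivity, fun R hR => ?_⟩
  obtain ⟨N, hN1, hN2⟩ : ∃ N : ℕ, R ≤ N ∧ (N : ℝ) ≤ 2 * R :=
    ⟨⌈R⌉₊, Nat.le_ceil R, by have := Nat.ceil_lt_add_one (a := R) (by linarith); linarith⟩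
  have hN0 : (0 : ℝ) < N := by linarith
  have : NeZero N := ⟨by rintro rfl; simp at hN0⟩
  rw [← (Int.divModEquiv N).symm.tsum_eq, ENNReal.tsum_prod']
  have key : ∀ (a : ℤ) (b : Fin N),
      ENNReal.ofReal (1 / (1 + ((((Int.divModEquiv N).symm (a, b) : ℤ) : ℝ) / R) ^ 2))
        ≤ ENNReal.ofReal (3 / (1 + (a : ℝ) ^ 2)) := by
    intro a b
    apply ENNReal.ofReal_le_ofReal
    have e : (((Int.divModEquiv N).symm (a, b) : ℤ) : ℝ) = a * N + (b : ℕ) := by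
      simp [Int.divModEquiv]
    rw [e]
    set x : ℝ := (a * N + (b : ℕ)) / R with hx
    have hb0 : (0 : ℝ) ≤ (b : ℕ) := by positivity
    have hbN : ((b : ℕ) : ℝ) ≤ N := by exact_mod_cast b.2.le
    have hxR : x * R = a * N + (b : ℕ) := by rw [hx]; field_simp
    have h1 : |(a : ℝ)| ≤ |x| + 1 := by
      have h2 : (a : ℝ) * N = x * R - (b : ℕ) := by linarith
      have h3 : |(a : ℝ)| * N ≤ (|x| + 1) * N := by
        calc |(a : ℝ)| * N = |x * R - (b : ℕ)| := by rw [← h2, abs_mul, abs_of_pos hN0]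
          _ ≤ |x * R| + |((b : ℕ) : ℝ)| := abs_sub _ _
          _ = |x| * R + (b : ℕ) := by rw [abs_mul, abs_of_pos (by linarith : 0 < R), abs_of_nonneg hb0]
          _ ≤ |x| * N + N := by gcongr
          _ = _ := by ring
      exact le_of_mul_le_mul_right h3 hN0
    rw [div_le_div_iff₀ (by positivity) (by positivity)]
    have h4 := abs_nonneg (a : ℝ)
    have h5 := abs_nonneg x
    rw [← sq_abs (a : ℝ), ← sq_abs x]
    nlinarith [sq_nonneg (|x| - 1)]
  calc _ ≤ ∑' (a : ℤ) (_ : Fin N), ENNReal.ofReal (3 / (1 + (a : ℝ) ^ 2)) :=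
        ENNReal.tsum_le_tsum fun a => ENNReal.tsum_le_tsum fun b => key a b
    _ = N * ENNReal.ofReal S := by
        simp only [tsum_fintype, Finset.sum_const, Finset.card_univ, Fintype.card_fin,
          nsmul_eq_mul]
        rw [ENNReal.tsum_mul_left, hSdef, ENNReal.ofReal_tsum_of_nonneg _ hS]
        intro k; positivity
    _ = ENNReal.ofReal (N * S) := by
        rw [ENNReal.ofReal_mul (by positivity), ENNReal.ofReal_natCast]
    _ ≤ _ := by
        apply ENNReal.ofReal_le_ofReal
        nlinarith

lemma aux_schwartz (d : ℕ) (ψ : SchwartzMap ℝ ℂ) :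
    ∃ K : ℝ, 0 < K ∧ ∀ t : ℝ, ‖ψ t‖ ≤ K * (1 / (1 + t ^ 2) ^ d) := by
  have h := fun x => SchwartzMap.one_add_le_sup_seminorm_apply (𝕜 := ℝ) (m := (2 * d, 0))
    (k := 2 * d) (n := 0) le_rfl le_rfl ψ x
  simp only [norm_iteratedFDeriv_zero] at h
  set B := 2 ^ (2 * d) * (((Finset.Iic (2 * d, 0)).sup
    fun m => SchwartzMap.seminorm ℝ m.1 m.2) ψ : ℝ) with hB
  have hB0 : 0 ≤ B := le_trans (by positivity) (h 0)
  refine ⟨B + 1, by positivity, fun t => ?_⟩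
  have h1 : (1 + t ^ 2) ^ d ≤ (1 + ‖t‖) ^ (2 * d) := by
    rw [pow_mul]
    gcongr
    rw [Real.norm_eq_abs, ← sq_abs t]
    nlinarith [abs_nonneg t]
  rw [mul_one_div, le_div_iff₀ (by positivity)]
  calc ‖ψ t‖ * (1 + t ^ 2) ^ d ≤ (1 + ‖t‖) ^ (2 * d) * ‖ψ t‖ := by
        rw [mul_comm]; gcongr
    _ ≤ B := h t
    _ ≤ _ := by linarith

lemma aux_weight (d : ℕ) (ψ : SchwartzMap ℝ ℂ) (q : ℝ) (hq : 1 ≤ q) :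
    ∃ C : ℝ, 0 < C ∧ ∀ R : ℝ, 1 ≤ R →
      ∑' j : Fin d → ℤ, ENNReal.ofReal (‖ψ (jnorm j / R)‖ ^ 2) ^ q
        ≤ ENNReal.ofReal (C * R ^ d) := by
  obtain ⟨A, hA, h1⟩ := aux_1d
  obtain ⟨K, hK, h2⟩ := aux_schwartz d ψ
  refine ⟨(K ^ 2) ^ q * A ^ d, by positivity, fun R hR => ?_⟩
  have key : ∀ j : Fin d → ℤ, ENNReal.ofReal (‖ψ (jnorm j / R)‖ ^ 2) ^ q
      ≤ ENNReal.ofReal ((K ^ 2) ^ q) *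
        ∏ m, ENNReal.ofReal (1 / (1 + ((j m : ℝ) / R) ^ 2)) := by
    intro j
    rw [ENNReal.ofReal_rpow_of_nonneg (by positivity) (by linarith),
      ← ENNReal.ofReal_prod_of_nonneg (fun m _ => by positivity),
      ← ENNReal.ofReal_mul (by positivity)]
    apply ENNReal.ofReal_le_ofReal
    set t := jnorm j / R with ht
    have ht2 : t ^ 2 = ∑ m, ((j m : ℝ) / R) ^ 2 := by
      rw [ht, div_pow, jnorm, Real.sq_sqrt (by positivity), Finset.sum_div]
      simp [div_pow]
    set u : ℝ := 1 / (1 + t ^ 2) ^ d with hu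
    have hu0 : 0 ≤ u := by positivity
    have hu1 : u ≤ 1 := by
      rw [hu, div_le_one (by positivity)]
      exact one_le_pow₀ (by nlinarith)
    have hup : u ≤ ∏ m, (1 / (1 + ((j m : ℝ) / R) ^ 2)) := by
      have : u = ∏ m : Fin d, (1 / (1 + t ^ 2)) := by simp [hu]
      rw [this]
      apply Finset.prod_le_prod
      · intro m _; positivity
      · intro m _
        refine one_div_le_one_div_of_le (by positivity) (add_le_add le_rfl ?_)
        rw [ht2]
        exact Finset.single_le_sum (f := fun m => ((j m : ℝ) / R) ^ 2)
          (fun i _ => by positivity) (Finset.mem_univ m)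
    calc (‖ψ t‖ ^ 2) ^ q ≤ ((K * u) ^ 2) ^ q := by
          have := h2 t
          gcongr
      _ = (K ^ 2) ^ q * (u ^ 2) ^ q := by
          rw [mul_pow, Real.mul_rpow (by positivity) (by positivity)]
      _ ≤ (K ^ 2) ^ q * u := by
          gcongr
          calc (u ^ 2) ^ q ≤ (u ^ 2) ^ (1 : ℝ) :=
                Real.rpow_le_rpow_of_exponent_ge' (by positivity) (by nlinarith) (by norm_num) hq
            _ = u ^ 2 := Real.rpow_one _
            _ ≤ u := by nlinarith
      _ ≤ _ := by gcongr
  calc _ ≤ ∑' j : Fin d → ℤ, ENNReal.ofReal ((K ^ 2) ^ q) *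
        ∏ m, ENNReal.ofReal (1 / (1 + ((j m : ℝ) / R) ^ 2)) := ENNReal.tsum_le_tsum key
    _ = ENNReal.ofReal ((K ^ 2) ^ q) *
        (∑' k : ℤ, ENNReal.ofReal (1 / (1 + ((k : ℝ) / R) ^ 2))) ^ d := by
        rw [ENNReal.tsum_mul_left,
          aux_tsum_pi d (fun k : ℤ => ENNReal.ofReal (1 / (1 + ((k : ℝ) / R) ^ 2)))]
    _ ≤ ENNReal.ofReal ((K ^ 2) ^ q) * ENNReal.ofReal (A * R) ^ d := by
        gcongr
        exact h1 R hR
    _ = _ := by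
        rw [← ENNReal.ofReal_pow (by positivity), ← ENNReal.ofReal_mul (by positivity), mul_pow,
          mul_assoc]

lemma aux_tsum_rpow {ι : Type*} (x : ι → ENNReal) (r : ℝ) (hr : 1 ≤ r) :
    ∑' i, x i ^ r ≤ (∑' i, x i) ^ r := by
  have e : r = 1 + (r - 1) := by ring
  have hs : ∀ y : ENNReal, y ^ r = y * y ^ (r - 1) := by
    intro y
    conv_lhs => rw [e]
    rw [ENNReal.rpow_add_of_nonneg _ _ (by norm_num) (by linarith), ENNReal.rpow_one]
  simp_rw [hs]
  rw [← ENNReal.tsum_mul_right]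
  refine ENNReal.tsum_le_tsum fun i => ?_
  gcongr
  exact ENNReal.le_tsum i

lemma aux_finite (d n : ℕ) : Finite {j : Fin d → ℤ // (∑ m, (j m) ^ 2) = (n : ℤ)} := by
  refine Set.Finite.to_subtype (s := {j : Fin d → ℤ | (∑ m, (j m) ^ 2) = (n : ℤ)})
    ((Set.finite_Icc (fun _ : Fin d => -(n : ℤ)) (fun _ => (n : ℤ))).subset ?_)
  intro j hj
  have hj : (∑ m, (j m) ^ 2) = (n : ℤ) := hj
  have h : ∀ m, (j m) ^ 2 ≤ (n : ℤ) := fun m => by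
    rw [← hj]
    exact Finset.single_le_sum (f := fun m => (j m) ^ 2)
      (fun i _ => by positivity) (Finset.mem_univ m)
  have h' : ∀ m, |j m| ≤ (n : ℤ) := fun m => by
    refine le_trans ?_ (h m)
    have := Int.le_self_sq |j m|
    rwa [sq_abs] at this
  exact ⟨fun m => (abs_le.1 (h' m)).1, fun m => (abs_le.1 (h' m)).2⟩

lemma aux_coeff {d : ℕ} (μ : ComplexMeasure (Torus d)) (p : ℝ) (hp : 2 < p) :
    ∑' j : Fin d → ℤ, ENNReal.ofReal (‖muHat μ j‖ ^ 2) ^ (p / 2)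
      ≤ ∑' n : ℕ, ENNReal.ofReal (aCoeff μ n ^ p) := by
  rw [← (Equiv.sigmaFiberEquiv (fun j : Fin d → ℤ => (∑ m, (j m) ^ 2).toNat)).tsum_eq,
    ENNReal.tsum_sigma']
  refine ENNReal.tsum_le_tsum fun n => ?_
  have hiff : ∀ j : Fin d → ℤ, (∑ m, (j m) ^ 2).toNat = n ↔ (∑ m, (j m) ^ 2) = (n : ℤ) := by
    intro j
    have : 0 ≤ ∑ m, (j m) ^ 2 := by positivity
    omega
  rw [← (Equiv.subtypeEquivRight hiff).symm.tsum_eq]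
  refine (aux_tsum_rpow _ _ (by linarith)).trans ?_
  have := aux_finite d n
  have hs : Summable (fun j : {j : Fin d → ℤ // (∑ m, (j m) ^ 2) = (n : ℤ)} =>
    ‖muHat μ (j : Fin d → ℤ)‖ ^ 2) := Summable.of_finite
  have e : ENNReal.ofReal (aCoeff μ n ^ p) =
      (∑' j : {j : Fin d → ℤ // (∑ m, (j m) ^ 2) = (n : ℤ)},
        ENNReal.ofReal (‖muHat μ (j : Fin d → ℤ)‖ ^ 2)) ^ (p / 2) := by
    rw [← ENNReal.ofReal_tsum_of_nonneg (fun _ => by positivity) hs,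
      ENNReal.ofReal_rpow_of_nonneg (tsum_nonneg fun _ => by positivity) (by linarith), aCoeff,
      Real.sqrt_eq_rpow, ← Real.rpow_mul (tsum_nonneg fun _ => by positivity)]
    congr 2
    ring
  rw [e]
  rfl

/-- **L² multiplier bound on the torus** (inequality (2.1) in the proof of Theorem 1.3):
for a Schwartz multiplier `ψ` and `p > 2`,
`Σ_j |ψ(|j|/R)|² |μ̂(j)|² ≤ C R^{d(1-2/p)} (Σ_n a_n(μ)^p)^{2/p}`, the inequality being
interpreted in the extended reals. -/
theorem L2_multiplier_bound_torus
    (d : ℕ) (hd : 1 ≤ d) (p : ℝ) (hp : 2 < p) (ψ : SchwartzMap ℝ ℂ) :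
    ∃ C : ℝ, 0 < C ∧
      ∀ (μ : ComplexMeasure (Torus d)) (R : ℝ), 1 ≤ R →
        (∑' j : Fin d → ℤ, ENNReal.ofReal (‖(ψ (jnorm j / R))‖ ^ 2 * ‖muHat μ j‖ ^ 2))
          ≤ ENNReal.ofReal (C * R ^ ((d : ℝ) * (1 - 2 / p)))
              * (∑' n : ℕ, ENNReal.ofReal (aCoeff μ n ^ p)) ^ (2 / p) := by
  have hp2 : 0 < p - 2 := by linarith
  have hp0 : 0 < p := by linarith
  have hq1 : 1 ≤ p / (p - 2) := by rw [le_div_iff₀ hp2]; linarith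
  have hq : (p / (p - 2)).HolderConjugate (p / 2) := by
    rw [Real.holderConjugate_iff]
    refine ⟨by rw [lt_div_iff₀ hp2]; linarith, ?_⟩
    rw [inv_div, inv_div]
    field_simp
    ring
  obtain ⟨C, hC, hw⟩ := aux_weight d ψ _ hq1
  have e1 : 1 / (p / (p - 2)) = 1 - 2 / p := by field_simp
  have e2 : 1 / (p / 2) = 2 / p := by field_simp
  have e0 : 0 ≤ 1 - 2 / p := by rw [← e1]; positivity
  refine ⟨C ^ (1 - 2 / p), by positivity, fun μ R hR => ?_⟩
  have hR0 : 0 < R := by linarith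
  rw [ENNReal.tsum_eq_iSup_sum]
  refine iSup_le fun s => ?_
  simp_rw [ENNReal.ofReal_mul (sq_nonneg _)]
  refine (ENNReal.inner_le_Lp_mul_Lq s _ _ hq).trans ?_
  rw [e1, e2]
  have hCR : ENNReal.ofReal (C ^ (1 - 2 / p) * R ^ ((d : ℝ) * (1 - 2 / p)))
      = ENNReal.ofReal (C * R ^ d) ^ (1 - 2 / p) := by
    rw [ENNReal.ofReal_rpow_of_nonneg (by positivity) e0,
      Real.mul_rpow (by positivity) (by positivity), Real.rpow_mul hR0.le, Real.rpow_natCast]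
  rw [hCR]
  refine mul_le_mul' (ENNReal.rpow_le_rpow ?_ e0) (ENNReal.rpow_le_rpow ?_ (by positivity))
  · exact (ENNReal.sum_le_tsum s).trans (hw R hR)
  · exact (ENNReal.sum_le_tsum s).trans (aux_coeff μ p hp)
end
end

section
/- Endpoint dyadic decay on the torus (the key limit in the proof of Proposition 2.3, case M = 𝕋^d): Let d ≥ 1, let k be a real number with 0 < k < d, and set p₀ = 2d/k. Let ψ : ℝ → ℂ be a Schwartz function. If μ is a finite complex Borel measure on 𝕋^d with Σ_{n ∈ ℕ} a_n(μ)^{p₀} < ∞, then R^{k−d} · Σ_{j ∈ ℤ^d} |ψ(|j|/R)|² |μ̂(j)|² → 0 as R → ∞ (limit along R → ∞ in ℝ). -/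
open MeasureTheory Complex Filter FourierTransform Metric
open scoped Real

noncomputable section

lemma aux_one (R : ℝ) (hR : 1 ≤ R) (N : ℕ) :
    ∑ i ∈ Finset.Icc (-(N:ℤ)) N, ((1 + |(i:ℝ)| / R)⁻¹) ^ 2 ≤ 3 * R := by
  have hR0 : 0 < R := by linarith
  have key : ∀ N : ℕ, ∑ i ∈ Finset.Icc (-(N:ℤ)) N, ((1 + |(i:ℝ)| / R)⁻¹) ^ 2
      ≤ 1 + 2 * R ^ 2 * (1 / R - 1 / (R + N)) := by
    intro N
    induction N with
    | zero => simp
    | succ n ih =>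
      have hset : Finset.Icc (-((n+1:ℕ):ℤ)) ((n+1:ℕ):ℤ)
          = insert (-((n+1:ℕ):ℤ)) (insert (((n+1:ℕ):ℤ)) (Finset.Icc (-(n:ℤ)) n)) := by
        ext x; simp only [Finset.mem_Icc, Finset.mem_insert]; omega
      rw [hset, Finset.sum_insert (by simp only [Finset.mem_Icc, Finset.mem_insert]; omega),
        Finset.sum_insert (by simp only [Finset.mem_Icc]; omega)]
      have hn : (0:ℝ) ≤ n := Nat.cast_nonneg n
      have habs : |(((n+1:ℕ):ℤ):ℝ)| = n + 1 := by
        push_cast; exact abs_of_nonneg (by positivity)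
      have habs' : |((-((n+1:ℕ):ℤ) : ℤ):ℝ)| = n + 1 := by
        rw [Int.cast_neg, abs_neg, habs]
      rw [habs, habs']
      have h1 : ((1 + ((n:ℝ) + 1) / R)⁻¹) ^ 2 ≤ R ^ 2 * (1 / (R + n) - 1 / (R + (n + 1))) := by
        have e1 : ((1 + ((n:ℝ) + 1) / R)⁻¹) ^ 2 = R ^ 2 * (1 / (R + (n+1)) ^ 2) := by
          field_simp
        have e2 : 1 / (R + (n:ℝ)) - 1 / (R + (n + 1)) = 1 / ((R + n) * (R + (n + 1))) := by
          field_simp; ring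
        rw [e1, e2]
        gcongr
        nlinarith
      push_cast
      linarith
  have h := key N
  have : 0 ≤ 1 / (R + (N:ℝ)) := by positivity
  have h2 : 2 * R ^ 2 * (1 / R - 1 / (R + N)) ≤ 2 * R ^ 2 * (1 / R) := by
    gcongr; linarith
  have h3 : 2 * R ^ 2 * (1 / R) = 2 * R := by field_simp
  linarith

lemma abs_le_jnorm {d : ℕ} (j : Fin d → ℤ) (m : Fin d) : |(j m : ℝ)| ≤ jnorm j := by
  unfold jnorm
  apply Real.abs_le_sqrt
  exact Finset.single_le_sum (f := fun m => ((j m : ℝ)) ^ 2) (fun i _ => sq_nonneg _)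
    (Finset.mem_univ m)

lemma jnorm_nonneg {d : ℕ} (j : Fin d → ℤ) : 0 ≤ jnorm j := Real.sqrt_nonneg _

lemma aux_v {d : ℕ} (R : ℝ) (hR : 1 ≤ R) (s : Finset (Fin d → ℤ)) :
    ∑ j ∈ s, ((1 + jnorm j / R)⁻¹) ^ (2 * d) ≤ (3 * R) ^ d := by
  have hR0 : 0 < R := by linarith
  obtain ⟨N, hN⟩ : ∃ N : ℕ, s ⊆ Fintype.piFinset (fun _ : Fin d => Finset.Icc (-(N:ℤ)) N) := by
    refine ⟨s.sup (fun j => Finset.univ.sup (fun m => (j m).natAbs)), ?_⟩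
    intro j hj
    rw [Fintype.mem_piFinset]
    intro m
    have h1 : (j m).natAbs ≤ Finset.univ.sup (fun m => (j m).natAbs) :=
      Finset.le_sup (f := fun m => (j m).natAbs) (Finset.mem_univ m)
    have h2 := Finset.le_sup (f := fun j : Fin d → ℤ => Finset.univ.sup (fun m => (j m).natAbs)) hj
    rw [Finset.mem_Icc]
    omega
  calc ∑ j ∈ s, ((1 + jnorm j / R)⁻¹) ^ (2 * d)
      ≤ ∑ j ∈ s, ∏ m, ((1 + |(j m:ℝ)| / R)⁻¹) ^ 2 := by
        refine Finset.sum_le_sum fun j _ => ?_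
        have : ((1 + jnorm j / R)⁻¹) ^ (2 * d) = ∏ m : Fin d, ((1 + jnorm j / R)⁻¹) ^ 2 := by
          simp [pow_mul]
        rw [this]
        have := jnorm_nonneg j
        refine Finset.prod_le_prod (fun m _ => by positivity) fun m _ => ?_
        have := abs_le_jnorm j m
        gcongr
    _ ≤ ∑ j ∈ Fintype.piFinset (fun _ : Fin d => Finset.Icc (-(N:ℤ)) N),
          ∏ m, ((1 + |(j m:ℝ)| / R)⁻¹) ^ 2 :=
        Finset.sum_le_sum_of_subset_of_nonneg hN fun j _ _ =>
          Finset.prod_nonneg fun m _ => by positivity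
    _ = ∏ m : Fin d, ∑ i ∈ Finset.Icc (-(N:ℤ)) N, ((1 + |(i:ℝ)| / R)⁻¹) ^ 2 :=
        (Finset.prod_univ_sum (fun _ : Fin d => Finset.Icc (-(N:ℤ)) N)
          (fun _ i => ((1 + |(i:ℝ)| / R)⁻¹) ^ 2)).symm
    _ ≤ ∏ m : Fin d, (3 * R) :=
        Finset.prod_le_prod (fun m _ => Finset.sum_nonneg fun i _ => by positivity)
          fun m _ => aux_one R hR N
    _ = (3 * R) ^ d := by simp

lemma aux_psi (ψ : SchwartzMap ℝ ℂ) (d : ℕ) : ∃ C : ℝ, 0 ≤ C ∧ ∀ x : ℝ, 0 ≤ x →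
    ‖ψ x‖ ^ 2 ≤ C * ((1 + x)⁻¹) ^ (2 * d) := by
  have h := fun x => SchwartzMap.one_add_le_sup_seminorm_apply (𝕜 := ℝ) (m := (d, 0))
    (k := d) (n := 0) le_rfl le_rfl ψ x
  obtain ⟨C, hC⟩ : ∃ C : ℝ, ∀ x : ℝ, (1 + ‖x‖) ^ d * ‖iteratedFDeriv ℝ 0 ψ x‖ ≤ C := ⟨_, h⟩
  refine ⟨C ^ 2, by positivity, fun x hx => ?_⟩
  have h1 := hC x
  rw [norm_iteratedFDeriv_zero, Real.norm_of_nonneg hx] at h1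
  have h2 : ((1 + x) ^ d * ‖ψ x‖) ^ 2 ≤ C ^ 2 := by gcongr
  rw [inv_pow, ← div_eq_mul_inv, le_div_iff₀ (by positivity)]
  calc _ = ((1 + x) ^ d * ‖ψ x‖) ^ 2 := by ring
    _ ≤ _ := h2

lemma aux_fin (d : ℕ) (n : ℤ) : Finite {j : Fin d → ℤ // (∑ m, (j m) ^ 2) = n} := by
  have : Set.Finite {j : Fin d → ℤ | (∑ m, (j m) ^ 2) = n} := by
    refine (Fintype.piFinset (fun _ : Fin d => Finset.Icc (-n) n)).finite_toSet.subset ?_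
    intro j hj
    change (∑ m, (j m) ^ 2) = n at hj
    simp only [Finset.mem_coe, Fintype.mem_piFinset, Finset.mem_Icc]
    intro m
    have h1 : (j m) ^ 2 ≤ n := by
      rw [← hj]
      exact Finset.single_le_sum (f := fun m => ((j m)) ^ 2) (fun i _ => sq_nonneg _)
        (Finset.mem_univ m)
    constructor
    · nlinarith [Int.le_self_sq (-(j m))]
    · nlinarith [Int.le_self_sq (j m)]
  exact this.to_subtype

lemma aux_summable_s5 {d : ℕ} (c : (Fin d → ℤ) → ℝ) (hc : ∀ j, 0 ≤ c j) (q : ℝ) (hq : 1 ≤ q)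
    (h : Summable fun n : ℕ =>
      (∑' j : {j : Fin d → ℤ // (∑ m, (j m) ^ 2) = (n : ℤ)}, c j) ^ q) :
    Summable fun j => c j ^ q := by
  have hnn : ∀ j : Fin d → ℤ, 0 ≤ ∑ m, (j m) ^ 2 := fun j => Finset.sum_nonneg fun m _ => sq_nonneg _
  let S : ℕ → ℝ := fun n => ∑' j : {j : Fin d → ℤ // (∑ m, (j m) ^ 2) = (n : ℤ)}, c j
  let e : (Σ n : ℕ, {j : Fin d → ℤ // (∑ m, (j m) ^ 2) = (n : ℤ)}) ≃ (Fin d → ℤ) :=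
    { toFun := fun x => x.2.1
      invFun := fun j => ⟨(∑ m, (j m) ^ 2).toNat, ⟨j, (Int.toNat_of_nonneg (hnn j)).symm⟩⟩
      left_inv := by
        rintro ⟨n, ⟨j, hj⟩⟩
        have : (∑ m, (j m) ^ 2).toNat = n := by omega
        subst this
        rfl
      right_inv := fun j => rfl }
  rw [← e.summable_iff]
  have hf : ∀ n : ℕ, Finite {j : Fin d → ℤ // (∑ m, (j m) ^ 2) = (n : ℤ)} := fun n => aux_fin d n
  rw [summable_sigma_of_nonneg (f := (fun j => c j ^ q) ∘ e) (fun x => Real.rpow_nonneg (hc _) _)]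
  refine ⟨fun n => Summable.of_finite, ?_⟩
  refine Summable.of_nonneg_of_le (fun n => tsum_nonneg fun x => Real.rpow_nonneg (hc _) _)
    (fun n => ?_) h
  change ∑' y : {j : Fin d → ℤ // (∑ m, (j m) ^ 2) = (n : ℤ)}, c y.1 ^ q ≤ S n ^ q
  have hS : 0 ≤ S n := tsum_nonneg fun x => hc _
  have split : ∀ x : ℝ, 0 ≤ x → x ^ q = x * x ^ (q - 1) := by
    intro x hx
    rw [← Real.rpow_one_add' hx (by linarith)]; congr 1; ring
  rw [split _ hS, ← tsum_mul_right]
  refine Summable.tsum_le_tsum (fun y => ?_) Summable.of_finite Summable.of_finite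
  rw [split _ (hc _)]
  have hle : c y.1 ≤ S n :=
    (Summable.of_finite (f := fun j : {j : Fin d → ℤ // (∑ m, (j m) ^ 2) = (n : ℤ)} => c j.1)).le_tsum
      y (fun j _ => hc _)
  exact mul_le_mul_of_nonneg_left
    (Real.rpow_le_rpow (hc _) hle (by linarith)) (hc _)

lemma aux_main_s5 {d : ℕ} (hd : 1 ≤ d) (k : ℝ) (hk0 : 0 < k) (hkd : k < d)
    (ψ : SchwartzMap ℝ ℂ) (c : (Fin d → ℤ) → ℝ) (hc : ∀ j, 0 ≤ c j)
    (hs : Summable fun j => c j ^ ((d:ℝ) / k)) :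
    Tendsto (fun R : ℝ =>
        R ^ (k - (d : ℝ)) * ∑' j : Fin d → ℤ, ‖(ψ (jnorm j / R))‖ ^ 2 * c j)
      atTop (nhds 0) := by
  have hd0 : (0:ℝ) < d := by linarith
  obtain ⟨C, hC0, hC⟩ := aux_psi ψ d
  set q : ℝ := (d:ℝ) / k with hq
  have hq1 : 1 < q := by rw [hq, lt_div_iff₀ hk0]; linarith
  have hpq : (Real.conjExponent q).HolderConjugate q := (Real.HolderConjugate.conjExponent hq1).symm
  set p : ℝ := Real.conjExponent q with hp
  have hp1 : 1 < p := hpq.lt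
  have hp0 : 0 < p := by linarith
  have hpinv : (d:ℝ) * (1 / p) = d - k := by
    have h1 := hpq.inv_add_inv_eq_one
    have h2 : q⁻¹ = k / d := by rw [hq, inv_div]
    have h3 : 1 / p = 1 - k / d := by rw [one_div]; linarith
    rw [h3]; field_simp
  set K : ℝ := C * ((3:ℝ) ^ d) ^ (1 / p) with hK
  have hK0 : 0 ≤ K := by positivity
  -- Hölder bound
  have holder : ∀ (η : ℝ), 0 ≤ η → ∀ R : ℝ, 1 ≤ R → ∀ t : Finset (Fin d → ℤ),
      ∑ j ∈ t, c j ^ q ≤ η ^ q →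
      ∑ j ∈ t, ‖(ψ (jnorm j / R))‖ ^ 2 * c j ≤ K * R ^ ((d:ℝ) - k) * η := by
    intro η hη R hR t ht
    have hR0 : 0 < R := by linarith
    have hv1 : ∀ j : Fin d → ℤ, ((1 + jnorm j / R)⁻¹) ^ (2 * d) ≤ 1 := by
      intro j
      have := jnorm_nonneg j
      refine pow_le_one₀ (by positivity) (inv_le_one_of_one_le₀ ?_)
      have : 0 ≤ jnorm j / R := by positivity
      linarith
    have hv0 : ∀ j : Fin d → ℤ, 0 ≤ ((1 + jnorm j / R)⁻¹) ^ (2 * d) := by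
      intro j
      have := jnorm_nonneg j
      positivity
    have h1 := Real.inner_le_Lp_mul_Lq t (fun j => ((1 + jnorm j / R)⁻¹) ^ (2 * d)) c hpq
    have h2 : ∑ j ∈ t, |((1 + jnorm j / R)⁻¹) ^ (2 * d)| ^ p ≤ (3 * R) ^ d := by
      refine (Finset.sum_le_sum fun j _ => ?_).trans (aux_v R hR t)
      rw [abs_of_nonneg (hv0 j)]
      calc _ ≤ (((1 + jnorm j / R)⁻¹) ^ (2 * d)) ^ (1:ℝ) :=
            Real.rpow_le_rpow_of_exponent_ge' (hv0 j) (hv1 j) zero_le_one hp1.le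
        _ = _ := Real.rpow_one _
    have h3 : ∑ j ∈ t, |c j| ^ q ≤ η ^ q := by
      simpa only [abs_of_nonneg (hc _)] using ht
    have h4 : (∑ j ∈ t, |c j| ^ q) ^ (1 / q) ≤ η := by
      calc _ ≤ (η ^ q) ^ (1 / q) := by
            gcongr
        _ = η := by rw [one_div, Real.rpow_rpow_inv hη (by linarith)]
    have h5 : (∑ j ∈ t, |((1 + jnorm j / R)⁻¹) ^ (2 * d)| ^ p) ^ (1 / p)
        ≤ ((3:ℝ) ^ d) ^ (1 / p) * R ^ ((d:ℝ) - k) := by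
      calc _ ≤ ((3 * R) ^ d) ^ (1 / p) := by
            gcongr
        _ = _ := by
            rw [mul_pow, Real.mul_rpow (by positivity) (by positivity), ← Real.rpow_natCast R d,
              ← Real.rpow_mul hR0.le, hpinv]
    calc ∑ j ∈ t, ‖(ψ (jnorm j / R))‖ ^ 2 * c j
        ≤ ∑ j ∈ t, C * (((1 + jnorm j / R)⁻¹) ^ (2 * d) * c j) := by
          refine Finset.sum_le_sum fun j _ => ?_
          rw [← mul_assoc]
          exact mul_le_mul_of_nonneg_right
            (hC _ (div_nonneg (jnorm_nonneg j) hR0.le)) (hc j)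
      _ = C * ∑ j ∈ t, (((1 + jnorm j / R)⁻¹) ^ (2 * d) * c j) := by rw [Finset.mul_sum]
      _ ≤ C * ((((3:ℝ) ^ d) ^ (1 / p) * R ^ ((d:ℝ) - k)) * η) := by
          refine mul_le_mul_of_nonneg_left (h1.trans ?_) hC0
          exact mul_le_mul h5 h4 (by positivity) (by positivity)
      _ = _ := by rw [hK]; ring
  rw [Metric.tendsto_atTop]
  intro δ hδ
  set η : ℝ := δ / (2 * (K + 1)) with hη
  have hη0 : 0 < η := by positivity
  have hKη : K * η < δ / 2 := by
    rw [hη, mul_div_assoc', div_lt_div_iff₀ (by positivity) (by positivity)]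
    nlinarith
  obtain ⟨F, hF⟩ := summable_iff_vanishing_norm.1 hs (η ^ q) (by positivity)
  have hlim : Tendsto (fun R : ℝ => R ^ (k - (d:ℝ)) * (∑ j ∈ F, C * c j)) atTop (nhds 0) := by
    have h := tendsto_rpow_neg_atTop (y := (d:ℝ) - k) (by linarith)
    have h' := h.mul_const (∑ j ∈ F, C * c j)
    simpa using h'
  obtain ⟨R₀, hR₀⟩ := Filter.eventually_atTop.1 (hlim.eventually (gt_mem_nhds (half_pos hδ)))
  refine ⟨max R₀ 1, fun R hR => ?_⟩
  have hR1 : 1 ≤ R := le_trans (le_max_right _ _) hR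
  have hR0 : 0 < R := by linarith
  have hsmall := hR₀ R (le_trans (le_max_left _ _) hR)
  have hterm : ∀ j : Fin d → ℤ, 0 ≤ ‖(ψ (jnorm j / R))‖ ^ 2 * c j := fun j =>
    mul_nonneg (by positivity) (hc j)
  have hbound : ∑' j : Fin d → ℤ, ‖(ψ (jnorm j / R))‖ ^ 2 * c j
      ≤ (∑ j ∈ F, C * c j) + K * R ^ ((d:ℝ) - k) * η := by
    refine Real.tsum_le_of_sum_le hterm fun s => ?_
    classical
    calc ∑ j ∈ s, ‖(ψ (jnorm j / R))‖ ^ 2 * c j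
        ≤ ∑ j ∈ F ∪ (s \ F), ‖(ψ (jnorm j / R))‖ ^ 2 * c j := by
          refine Finset.sum_le_sum_of_subset_of_nonneg ?_ fun j _ _ => hterm j
          rw [Finset.union_sdiff_self_eq_union]
          exact Finset.subset_union_right
      _ = ∑ j ∈ F, ‖(ψ (jnorm j / R))‖ ^ 2 * c j + ∑ j ∈ s \ F, ‖(ψ (jnorm j / R))‖ ^ 2 * c j :=
          Finset.sum_union Finset.disjoint_sdiff
      _ ≤ _ := by
          refine add_le_add (Finset.sum_le_sum fun j _ => ?_) ?_
          · refine mul_le_mul_of_nonneg_right ?_ (hc j)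
            have hx : 0 ≤ jnorm j / R := div_nonneg (jnorm_nonneg j) hR0.le
            refine (hC _ hx).trans (mul_le_of_le_one_right hC0 ?_)
            exact pow_le_one₀ (by positivity) (inv_le_one_of_one_le₀ (by linarith))
          · refine holder η hη0.le R hR1 _ ?_
            exact (Real.le_norm_self _).trans (hF _ Finset.sdiff_disjoint).le
  rw [Real.dist_0_eq_abs, abs_of_nonneg (mul_nonneg (by positivity) (tsum_nonneg hterm))]
  have hcancel : R ^ (k - (d:ℝ)) * R ^ ((d:ℝ) - k) = 1 := by
    rw [← Real.rpow_add hR0]; simp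
  calc _ ≤ R ^ (k - (d:ℝ)) * ((∑ j ∈ F, C * c j) + K * R ^ ((d:ℝ) - k) * η) := by gcongr
    _ = R ^ (k - (d:ℝ)) * (∑ j ∈ F, C * c j)
        + (R ^ (k - (d:ℝ)) * R ^ ((d:ℝ) - k)) * (K * η) := by ring
    _ < δ := by rw [hcancel]; linarith

/-- **Endpoint dyadic decay on the torus** (the key limit in the proof of
Proposition 2.3): if `p₀ = 2d/k` and `Σ_n a_n(μ)^{p₀} < ∞`, then
`R^{k-d} Σ_j |ψ(|j|/R)|² |μ̂(j)|² → 0` as `R → ∞`. -/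
theorem endpoint_dyadic_decay_torus
    (d : ℕ) (hd : 1 ≤ d) (k : ℝ) (hk0 : 0 < k) (hkd : k < d)
    (ψ : SchwartzMap ℝ ℂ)
    (μ : ComplexMeasure (Torus d))
    (hsum : Summable (fun n : ℕ => aCoeff μ n ^ (2 * (d : ℝ) / k))) :
    Tendsto (fun R : ℝ =>
        R ^ (k - (d : ℝ)) *
          ∑' j : Fin d → ℤ, ‖(ψ (jnorm j / R))‖ ^ 2 * ‖muHat μ j‖ ^ 2)
      atTop (nhds 0) := by
  refine aux_main_s5 hd k hk0 hkd ψ (fun j => ‖muHat μ j‖ ^ 2) (fun j => by positivity) ?_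
  refine aux_summable_s5 _ (fun j => by positivity) _ ?_ ?_
  · rw [le_div_iff₀ hk0]; linarith
  · refine hsum.congr fun n => ?_
    rw [aCoeff, Real.sqrt_eq_rpow, ← Real.rpow_mul (tsum_nonneg fun j => by positivity)]
    congr 1
    ring
end
end

section
/- Pigeonhole extraction of large spectral projections from Kuznecov-type asymptotics (the key step in the proof of Proposition 1.5): Let α ≥ 1 be a real number, let S ⊆ [0,∞) be a set, let c : ℝ → ℝ be nonnegative, and let T > 0, K ∈ ℕ, C > 0, C' ≥ 0, x₀ ≥ 1 be constants. Assume: (a) for every n ∈ ℕ, the set S ∩ (nT, (n+1)T] is finite with at most K elements; (b) for every x ≥ x₀, the set S ∩ [0, x] is finite and |Σ_{λ ∈ S ∩ [0,x]} c(λ) − C·x^α| ≤ C'·x^{α−1}. Then there exists c₃ > 0 such that for every X ≥ 0 there exists λ ∈ S with λ ≥ X and c(λ) ≥ c₃ · λ^{α−1}. -/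
open Set

theorem aux_tsum (s : Set ℝ) (hs : s.Finite) (c : ℝ → ℝ) :
    (∑' x : s, c (x : ℝ)) = ∑ x ∈ hs.toFinset, c x := by
  have h := Finset.tsum_subtype' hs.toFinset c
  rw [hs.coe_toFinset] at h
  exact h

theorem aux_card (S : Set ℝ) (T : ℝ) (hT : 0 < T) (K : ℕ)
    (hwindow : ∀ n : ℕ, (S ∩ Set.Ioc ((n : ℝ) * T) (((n : ℝ) + 1) * T)).Finite ∧
      (S ∩ Set.Ioc ((n : ℝ) * T) (((n : ℝ) + 1) * T)).ncard ≤ K) (n M : ℕ) :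
    (S ∩ Set.Ioc ((n : ℝ) * T) (((n : ℝ) + M) * T)).Finite ∧
      (S ∩ Set.Ioc ((n : ℝ) * T) (((n : ℝ) + M) * T)).ncard ≤ M * K := by
  induction M with
  | zero => simp
  | succ M ih =>
    have hw := hwindow (n + M)
    push_cast at hw ⊢
    have hsub : S ∩ Set.Ioc ((n : ℝ) * T) (((n : ℝ) + (M + 1)) * T) ⊆
        (S ∩ Set.Ioc ((n : ℝ) * T) (((n : ℝ) + M) * T)) ∪
        (S ∩ Set.Ioc (((n : ℝ) + M) * T) (((n : ℝ) + M + 1) * T)) := by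
      rintro x ⟨hx, h1, h2⟩
      by_cases h : x ≤ ((n : ℝ) + M) * T
      · exact Or.inl ⟨hx, h1, h⟩
      · exact Or.inr ⟨hx, not_le.mp h, by rw [add_assoc]; exact h2⟩
    have hf := ih.1.union hw.1
    refine ⟨hf.subset hsub, (Set.ncard_le_ncard hsub hf).trans
      ((Set.ncard_union_le _ _).trans ?_)⟩
    have := ih.2
    have := hw.2
    rw [Nat.succ_mul]
    omega

/-- **Pigeonhole extraction of large spectral projections from Kuznecov-type
asymptotics** (the key step in the proof of Proposition 1.5): if a set `S ⊆ [0,∞)`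
has at most `K` points in each interval `(nT, (n+1)T]` and the cumulative sums of a
nonnegative weight `c` over `S ∩ [0,x]` obey the asymptotic `C x^α + O(x^{α-1})` with
`C > 0`, then there are arbitrarily large `λ ∈ S` with `c(λ) ≥ c₃ λ^{α-1}`. -/
theorem pigeonhole_kuznecov
    (α : ℝ) (hα : 1 ≤ α)
    (S : Set ℝ) (hS : S ⊆ Set.Ici 0)
    (c : ℝ → ℝ) (hc : ∀ x : ℝ, 0 ≤ c x)
    (T : ℝ) (hT : 0 < T) (K : ℕ)
    (C C' x₀ : ℝ) (hC : 0 < C) (hC' : 0 ≤ C') (hx₀ : 1 ≤ x₀)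
    (hwindow : ∀ n : ℕ, (S ∩ Set.Ioc ((n : ℝ) * T) (((n : ℝ) + 1) * T)).Finite ∧
      (S ∩ Set.Ioc ((n : ℝ) * T) (((n : ℝ) + 1) * T)).ncard ≤ K)
    (hfin : ∀ x : ℝ, x₀ ≤ x → (S ∩ Set.Icc 0 x).Finite)
    (hasymp : ∀ x : ℝ, x₀ ≤ x →
      |(∑' lam : (S ∩ Set.Icc 0 x : Set ℝ), c (lam : ℝ)) - C * x ^ α| ≤ C' * x ^ (α - 1)) :
    ∃ c₃ : ℝ, 0 < c₃ ∧
      ∀ X : ℝ, 0 ≤ X → ∃ lam : ℝ, lam ∈ S ∧ X ≤ lam ∧ c₃ * lam ^ (α - 1) ≤ c lam := by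
  obtain ⟨M, hM⟩ := exists_nat_ge ((2 * C' + 1) / (C * T))
  rw [div_le_iff₀ (by positivity)] at hM
  refine ⟨1 / ((M * K : ℕ) + 1 : ℝ), by positivity, ?_⟩
  intro X hX
  by_contra! hcon
  obtain ⟨n, hn⟩ := exists_nat_ge (max x₀ X / T)
  rw [div_le_iff₀ hT] at hn
  have ha0 : x₀ ≤ n * T := (le_max_left _ _).trans hn
  have haX : X ≤ n * T := (le_max_right _ _).trans hn
  obtain ⟨hf, hcard⟩ := aux_card S T hT K hwindow n M
  have hab : (n : ℝ) * T ≤ ((n : ℝ) + M) * T := by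
    have : (0 : ℝ) ≤ M * T := by positivity
    linarith
  have hba : ((n : ℝ) + M) * T - n * T = M * T := by ring
  set a := (n : ℝ) * T with ha
  set b := ((n : ℝ) + M) * T with hb
  have hb0 := ha0.trans hab
  have hA := hasymp a ha0
  have hB := hasymp b hb0
  rw [aux_tsum _ (hfin a ha0)] at hA
  rw [aux_tsum _ (hfin b hb0)] at hB
  have hapos : 0 < a := by linarith
  have hbpos : 0 < b := by linarith
  have hsplit : (∑ x ∈ (hfin b hb0).toFinset, c x) =
      (∑ x ∈ (hfin a ha0).toFinset, c x) + ∑ x ∈ hf.toFinset, c x := by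
    rw [← Finset.sum_union]
    · congr 1
      ext x
      simp only [Set.Finite.mem_toFinset, Finset.mem_union, Set.mem_inter_iff, Set.mem_Icc,
        Set.mem_Ioc]
      constructor
      · rintro ⟨h1, h2, h3⟩
        by_cases h : x ≤ a
        · exact Or.inl ⟨h1, h2, h⟩
        · exact Or.inr ⟨h1, not_le.mp h, h3⟩
      · rintro (⟨h1, h2, h3⟩ | ⟨h1, h2, h3⟩)
        · exact ⟨h1, h2, h3.trans hab⟩
        · exact ⟨h1, by linarith, h3⟩
    · rw [Finset.disjoint_left]
      intro x h1 h2
      simp only [Set.Finite.mem_toFinset, Set.mem_inter_iff, Set.mem_Icc, Set.mem_Ioc] at h1 h2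
      linarith [h1.2.2, h2.2.1]
  have hpow : ∀ y : ℝ, 0 < y → y ^ α = y * y ^ (α - 1) := by
    intro y hy
    rw [Real.rpow_sub_one hy.ne']
    field_simp
  rw [hpow a hapos] at hA
  rw [hpow b hbpos] at hB
  have hmono : a ^ (α - 1) ≤ b ^ (α - 1) :=
    Real.rpow_le_rpow hapos.le hab (by linarith)
  have hBpos : 0 < b ^ (α - 1) := Real.rpow_pos_of_pos hbpos _
  have hup : ∑ x ∈ hf.toFinset, c x ≤
      hf.toFinset.card • (1 / ((M * K : ℕ) + 1 : ℝ) * b ^ (α - 1)) := by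
    apply Finset.sum_le_card_nsmul
    intro x hx
    simp only [Set.Finite.mem_toFinset, Set.mem_inter_iff, Set.mem_Ioc] at hx
    refine (hcon x hx.1 (by linarith [hx.2.1])).le.trans ?_
    have : x ^ (α - 1) ≤ b ^ (α - 1) :=
      Real.rpow_le_rpow (by linarith [hx.2.1]) hx.2.2 (by linarith)
    gcongr
  rw [Set.ncard_eq_toFinset_card _ hf] at hcard
  have hcard' : (hf.toFinset.card : ℝ) ≤ (M * K : ℕ) := by exact_mod_cast hcard
  have hlt : ∑ x ∈ hf.toFinset, c x < b ^ (α - 1) := by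
    refine hup.trans_lt ?_
    rw [nsmul_eq_mul, ← mul_assoc, mul_one_div]
    have : (hf.toFinset.card : ℝ) / ((M * K : ℕ) + 1 : ℝ) < 1 := by
      rw [div_lt_one (by positivity)]
      linarith
    nlinarith
  generalize (∑ x ∈ hf.toFinset, c x) = s at *
  generalize (∑ x ∈ (hfin a ha0).toFinset, c x) = sa at *
  generalize a ^ (α - 1) = A at *
  generalize b ^ (α - 1) = B at *
  have h1 := (abs_le.mp hA).2
  have h2 := (abs_le.mp hB).1
  rw [hsplit] at h2
  have h3 : a * A ≤ a * B := mul_le_mul_of_nonneg_left hmono hapos.le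
  have h4 : C * (a * A) ≤ C * (a * B) := mul_le_mul_of_nonneg_left h3 hC.le
  have h5 : C' * A ≤ C' * B := mul_le_mul_of_nonneg_left hmono hC'
  have h6 : (2 * C' + 1) * B ≤ M * (C * T) * B := mul_le_mul_of_nonneg_right hM hBpos.le
  have h7 : C * (b * B) = C * (a * B) + M * (C * T) * B := by
    have : b = a + M * T := by linarith
    rw [this]; ring
  linarith
end
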